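/- arXiv:0805.1699 — 3 statements merged into one kernel-verified Lean document; each statement's English description precedes it below -/
import Mathlib

section
/- Let J₀ = [A, B] be a compact interval and let s_{n,k} ∈ [0, 1] be an array of numbers, defined for n = 1, 2, … and integers k with k/n ∈ J₀. The following three conditions are equivalent: (a) for every pair of intervals I ⊆ [0, 1] and J ⊆ J₀, (1/n)·N_n → |I|·|J| as n → ∞, where N_n is the number of integers k with k/n ∈ J and s_{n,k} ∈ I, and |I|, |J| are the lengths of I and J; (b) for every nonzero integer j and every subinterval J of J₀, (1/n) Σ_{k : k/n ∈ J} exp(2πi j s_{n,k}) → 0 as n → ∞; (c) for every function f Riemann integrable on J₀ and every function g Riemann integrable on [0, 1], (1/n) Σ_{k : k/n ∈ J₀} f(k/n) g(s_{n,k}) → (∫_{J₀} f) · (∫_0^1 g) as n → ∞. -/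
open MeasureTheory Filter Set
open scoped Real Topology Classical

/-- `f` is Riemann integrable on `[a,b]`: bounded there and (by Lebesgue's criterion)
continuous at almost every point of `[a,b]`.  For such functions the Riemann integral
coincides with the Lebesgue integral `∫ x in a..b, f x`. -/
def RiemannIntegrableOn (f : ℝ → ℝ) (a b : ℝ) : Prop :=
  (∃ M : ℝ, ∀ x ∈ Set.Icc a b, |f x| ≤ M) ∧
    ∀ᵐ x ∂(volume.restrict (Set.Icc a b)), ContinuousWithinAt f (Set.Icc a b) x

/-- The finset of integers `k` with `k/n ∈ J`, for `J ⊆ [A,B]`. -/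
noncomputable def idxFinset (A B : ℝ) (n : ℕ) (J : Set ℝ) : Finset ℤ :=
  (Finset.Icc ⌈A * n⌉ ⌊B * n⌋).filter fun k : ℤ => (k : ℝ) / n ∈ J

/-- Condition (a): for every pair of intervals `I ⊆ [0,1]`, `J ⊆ J₀`, the proportion of
indices `k` with `k/n ∈ J` and `s_{n,k} ∈ I` tends to `|I|·|J|`. -/
def CondA (A B : ℝ) (s : ℕ → ℤ → ℝ) : Prop :=
  ∀ I J : Set ℝ, I.OrdConnected → J.OrdConnected → I ⊆ Set.Icc 0 1 →
    J ⊆ Set.Icc A B →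
    Tendsto
      (fun n : ℕ =>
        (((idxFinset A B n J).filter fun k : ℤ => s n k ∈ I).card : ℝ) / n)
      atTop (nhds ((volume I).toReal * (volume J).toReal))

/-- Condition (b): Weyl sums over any subinterval tend to zero. -/
def CondB (A B : ℝ) (s : ℕ → ℤ → ℝ) : Prop :=
  ∀ j : ℤ, j ≠ 0 → ∀ J : Set ℝ, J.OrdConnected → J ⊆ Set.Icc A B →
    Tendsto
      (fun n : ℕ => (1 / (n : ℂ)) *
        ∑ k ∈ idxFinset A B n J,
          Complex.exp (2 * Real.pi * Complex.I * (j : ℂ) * (s n k : ℂ)))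
      atTop (nhds 0)

/-- Condition (c): weighted averages converge to the product of the integrals for all
Riemann integrable weights. -/
def CondC (A B : ℝ) (s : ℕ → ℤ → ℝ) : Prop :=
  ∀ f g : ℝ → ℝ, RiemannIntegrableOn f A B → RiemannIntegrableOn g 0 1 →
    Tendsto
      (fun n : ℕ => (1 / (n : ℝ)) *
        ∑ k ∈ idxFinset A B n (Set.Icc A B), f ((k : ℝ) / n) * g (s n k))
      atTop (nhds ((∫ x in A..B, f x) * ∫ x in (0:ℝ)..1, g x))


/-- Upper Lipschitz regularisation of `f` on `[a,b]`, pinned to `M` at the end points. -/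
noncomputable def upReg (f : ℝ → ℝ) (a b M : ℝ) (m : ℕ) (x : ℝ) : ℝ :=
  max (⨆ y : Set.Icc a b, (f y - m * |x - y|)) (max (M - m * (x - a)) (M - m * (b - x)))

section upReg
variable {f : ℝ → ℝ} {a b M : ℝ}

lemma upReg_bdd (hM : ∀ x ∈ Set.Icc a b, |f x| ≤ M) (m : ℕ) (x : ℝ) :
    BddAbove (Set.range fun y : Set.Icc a b => (f y - m * |x - y|)) := by
  refine ⟨M, ?_⟩
  rintro _ ⟨y, rfl⟩
  have := (abs_le.1 (hM y y.2)).2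
  have h2 : 0 ≤ (m:ℝ) * |x - y| := by positivity
  simp only
  linarith

lemma le_upReg (hM : ∀ x ∈ Set.Icc a b, |f x| ≤ M) (m : ℕ) {x : ℝ} (hx : x ∈ Set.Icc a b) :
    f x ≤ upReg f a b M m x := by
  refine le_trans ?_ (le_max_left _ _)
  have := le_ciSup (upReg_bdd hM m x) ⟨x, hx⟩
  simpa using this

lemma upReg_le (hab : a ≤ b) (hM : ∀ x ∈ Set.Icc a b, |f x| ≤ M) (m : ℕ) {x : ℝ}
    (hx : x ∈ Set.Icc a b) : upReg f a b M m x ≤ M := by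
  have : Nonempty (Set.Icc a b) := ⟨⟨a, le_rfl, hab⟩⟩
  have hm : (0:ℝ) ≤ m := by positivity
  refine max_le (ciSup_le fun y => ?_) (max_le ?_ ?_)
  · have := (abs_le.1 (hM y y.2)).2
    have h2 : 0 ≤ (m:ℝ) * |x - y| := by positivity
    linarith
  · have := mul_nonneg hm (sub_nonneg.2 hx.1); linarith
  · have := mul_nonneg hm (sub_nonneg.2 hx.2); linarith

lemma upReg_left (hab : a ≤ b) (hM : ∀ x ∈ Set.Icc a b, |f x| ≤ M) (m : ℕ) :
    upReg f a b M m a = M := by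
  refine le_antisymm (upReg_le hab hM m ⟨le_rfl, hab⟩) ?_
  refine le_trans ?_ (le_max_right _ _)
  refine le_trans ?_ (le_max_left _ _)
  simp

lemma upReg_right (hab : a ≤ b) (hM : ∀ x ∈ Set.Icc a b, |f x| ≤ M) (m : ℕ) :
    upReg f a b M m b = M := by
  refine le_antisymm (upReg_le hab hM m ⟨hab, le_rfl⟩) ?_
  refine le_trans ?_ (le_max_right _ _)
  refine le_trans ?_ (le_max_right _ _)
  simp

lemma upReg_uc (hab : a ≤ b) (hM : ∀ x ∈ Set.Icc a b, |f x| ≤ M) (m : ℕ) :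
    UniformContinuous (upReg f a b M m) := by
  have : Nonempty (Set.Icc a b) := ⟨⟨a, le_rfl, hab⟩⟩
  have hm : (0:ℝ) ≤ m := by positivity
  have h1 : LipschitzWith m (fun x : ℝ => ⨆ y : Set.Icc a b, (f y - m * |x - y|)) := by
    refine LipschitzWith.of_le_add_mul _ fun x z => ciSup_le fun y => ?_
    have h := le_ciSup (upReg_bdd hM m z) y
    have h3 : |z - y| ≤ |x - y| + dist x z := by
      rw [Real.dist_eq, abs_sub_comm x z, add_comm]
      exact abs_sub_le z x y
    have h4 := mul_le_mul_of_nonneg_left h3 hm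
    simp only [NNReal.coe_natCast] at *
    linarith
  have h2 : LipschitzWith m (fun x => M - m * (x - a)) := by
    refine LipschitzWith.of_le_add_mul _ fun x z => ?_
    have h3 : z - x ≤ dist x z := by rw [dist_comm]; exact le_abs_self _
    have h4 := mul_le_mul_of_nonneg_left h3 hm
    simp only [NNReal.coe_natCast] at *
    linarith
  have h2' : LipschitzWith m (fun x => M - m * (b - x)) := by
    refine LipschitzWith.of_le_add_mul _ fun x z => ?_
    have h3 : x - z ≤ dist x z := le_abs_self _
    have h4 := mul_le_mul_of_nonneg_left h3 hm
    simp only [NNReal.coe_natCast] at *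
    linarith
  exact (h1.max (h2.max h2')).uniformContinuous

lemma upReg_tendsto (hM : ∀ x ∈ Set.Icc a b, |f x| ≤ M) {x : ℝ}
    (hx : x ∈ Set.Ioo a b) (hc : ContinuousWithinAt f (Set.Icc a b) x) :
    Tendsto (fun m => upReg f a b M m x) atTop (𝓝 (f x)) := by
  have hxI := Set.Ioo_subset_Icc_self hx
  have : Nonempty (Set.Icc a b) := ⟨⟨x, hxI⟩⟩
  rw [Metric.tendsto_atTop]
  intro ε hε
  obtain ⟨δ, hδ, hd⟩ := Metric.continuousWithinAt_iff.1 hc (ε/2) (by positivity)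
  set η := min δ (min (x - a) (b - x)) with hη
  have hη0 : 0 < η := lt_min hδ (lt_min (sub_pos.2 hx.1) (sub_pos.2 hx.2))
  have hηδ : η ≤ δ := min_le_left _ _
  have hη1 : η ≤ x - a := (min_le_right _ _).trans (min_le_left _ _)
  have hη2 : η ≤ b - x := (min_le_right _ _).trans (min_le_right _ _)
  obtain ⟨N, hN⟩ := exists_nat_ge (2 * M / η)
  rw [div_le_iff₀ hη0] at hN
  refine ⟨N, fun m hm => ?_⟩
  have hm' : (N:ℝ) ≤ m := by exact_mod_cast hm
  have hmη : 2 * M ≤ m * η := hN.trans (mul_le_mul_of_nonneg_right hm' hη0.le)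
  have hm0 : (0:ℝ) ≤ m := by positivity
  have hfx := abs_le.1 (hM x hxI)
  have hup : upReg f a b M m x ≤ f x + ε/2 := by
    refine max_le (ciSup_le fun y => ?_) (max_le ?_ ?_)
    · have hfy := abs_le.1 (hM y y.2)
      by_cases h : |x - y| < η
      · have h1 := hd y.2 (by rw [dist_comm, Real.dist_eq]; exact h.trans_le hηδ)
        have h2 := (abs_lt.1 (Real.dist_eq _ _ ▸ h1)).2
        have h3 : 0 ≤ (m:ℝ) * |x - y| := by positivity
        linarith
      · have := mul_le_mul_of_nonneg_left (not_lt.1 h) hm0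
        linarith
    · have := mul_le_mul_of_nonneg_left hη1 hm0
      linarith
    · have := mul_le_mul_of_nonneg_left hη2 hm0
      linarith
  have hlo := le_upReg hM m hxI
  rw [Real.dist_eq, abs_lt]
  constructor <;> linarith

end upReg

lemma riemann_approx {f : ℝ → ℝ} {a b : ℝ} (hab : a ≤ b) (hf : RiemannIntegrableOn f a b) :
    IntervalIntegrable f volume a b ∧ ∀ ε > 0, ∃ ψ : ℝ → ℝ, UniformContinuous ψ ∧ ψ a = ψ b ∧
      (∀ x ∈ Set.Icc a b, f x ≤ ψ x) ∧ ∫ x in a..b, ψ x ≤ (∫ x in a..b, f x) + ε := by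
  obtain ⟨⟨M, hM⟩, hc⟩ := hf
  have hlim : ∀ᵐ x ∂(volume.restrict (Set.Ioc a b)),
      Tendsto (fun m => upReg f a b M m x) atTop (𝓝 (f x)) := by
    rw [← Measure.restrict_congr_set (Ioo_ae_eq_Ioc (a := a) (b := b) (μ := volume))]
    have h1 := ae_restrict_of_ae_restrict_of_subset (Set.Ioo_subset_Icc_self) hc
    filter_upwards [h1, ae_restrict_mem measurableSet_Ioo] with x h1 h2
    exact upReg_tendsto hM h2 h1
  have hmeas : AEStronglyMeasurable f (volume.restrict (Set.Ioc a b)) :=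
    aestronglyMeasurable_of_tendsto_ae atTop
      (fun m => (upReg_uc hab hM m).continuous.aestronglyMeasurable) hlim
  have hint : IntervalIntegrable f volume a b := by
    rw [intervalIntegrable_iff_integrableOn_Ioc_of_le hab]
    refine Integrable.of_bound hmeas M ?_
    filter_upwards [ae_restrict_mem measurableSet_Ioc] with x hx
    exact hM x (Set.Ioc_subset_Icc_self hx)
  refine ⟨hint, fun ε hε => ?_⟩
  have htend : Tendsto (fun m => ∫ x in a..b, upReg f a b M m x) atTop
      (𝓝 (∫ x in a..b, f x)) := by
    refine intervalIntegral.tendsto_integral_filter_of_dominated_convergence (fun _ => M)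
      ?_ ?_ ?_ ?_
    · exact Eventually.of_forall fun m => (upReg_uc hab hM m).continuous.aestronglyMeasurable
    · refine Eventually.of_forall fun m => Eventually.of_forall fun x hx => ?_
      rw [Set.uIoc_of_le hab] at hx
      have hx' := Set.Ioc_subset_Icc_self hx
      rw [Real.norm_eq_abs, abs_le]
      exact ⟨(abs_le.1 (hM x hx')).1.trans (le_upReg hM m hx'), upReg_le hab hM m hx'⟩
    · simp
    · rw [Set.uIoc_of_le hab]
      exact (ae_restrict_iff' measurableSet_Ioc).1 hlim
  obtain ⟨m, hm⟩ := (htend.eventually (gt_mem_nhds (lt_add_of_pos_right _ hε))).exists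
  exact ⟨_, upReg_uc hab hM m, by rw [upReg_left hab hM, upReg_right hab hM],
    fun x hx => le_upReg hM m hx, hm.le⟩

/-- `f` satisfies the equidistribution limit for the weighted points `x n k`. -/
def GoodFn (a b c : ℝ) (S : ℕ → Finset ℤ) (w x : ℕ → ℤ → ℝ) (f : ℝ → ℝ) : Prop :=
  IntervalIntegrable f volume a b ∧
    Tendsto (fun n => ∑ k ∈ S n, w n k * f (x n k)) atTop (𝓝 (c * ∫ t in a..b, f t))

section Good
variable {a b c : ℝ} {S : ℕ → Finset ℤ} {w x : ℕ → ℤ → ℝ} {f g : ℝ → ℝ}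

lemma GoodFn.add (hf : GoodFn a b c S w x f) (hg : GoodFn a b c S w x g) :
    GoodFn a b c S w x (fun t => f t + g t) := by
  refine ⟨hf.1.add hg.1, ?_⟩
  rw [intervalIntegral.integral_add hf.1 hg.1, mul_add]
  simpa only [mul_add, Finset.sum_add_distrib] using hf.2.add hg.2

lemma GoodFn.smul (r : ℝ) (hf : GoodFn a b c S w x f) :
    GoodFn a b c S w x (fun t => r * f t) := by
  refine ⟨hf.1.const_mul r, ?_⟩
  rw [intervalIntegral.integral_const_mul, mul_left_comm]
  have := hf.2.const_mul r
  simpa only [Finset.mul_sum, mul_left_comm r] using this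

lemma GoodFn.zero : GoodFn a b c S w x (fun _ => 0) := by
  refine ⟨intervalIntegrable_const, by simp⟩

lemma GoodFn.sum {ι : Type*} (T : Finset ι) (F : ι → ℝ → ℝ)
    (h : ∀ i ∈ T, GoodFn a b c S w x (F i)) :
    GoodFn a b c S w x (fun t => ∑ i ∈ T, F i t) := by
  induction T using Finset.induction_on with
  | empty => simpa using GoodFn.zero
  | insert i T hi ih =>
    simp only [Finset.sum_insert hi]
    exact (h i (by simp)).add (ih fun j hj => h j (by simp [hj]))

lemma GoodFn.sandwich (hab : a ≤ b) (hc : 0 ≤ c) (hw : ∀ n, ∀ k ∈ S n, 0 ≤ w n k)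
    (hx : ∀ n, ∀ k ∈ S n, x n k ∈ Set.Icc a b) (hf : IntervalIntegrable f volume a b)
    (h : ∀ ε > 0, ∃ φ ψ, GoodFn a b c S w x φ ∧ GoodFn a b c S w x ψ ∧
      (∀ t ∈ Set.Icc a b, φ t ≤ f t) ∧ (∀ t ∈ Set.Icc a b, f t ≤ ψ t) ∧
      ∫ t in a..b, ψ t ≤ (∫ t in a..b, φ t) + ε) : GoodFn a b c S w x f := by
  refine ⟨hf, ?_⟩
  rw [Metric.tendsto_atTop]
  intro ε hε
  obtain ⟨φ, ψ, hφ, hψ, h1, h2, h3⟩ := h (ε / (2 * (c + 1))) (by positivity)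
  have i1 := intervalIntegral.integral_mono_on hab hφ.1 hf h1
  have i2 := intervalIntegral.integral_mono_on hab hf hψ.1 h2
  have e1 : c * (ε / (2 * (c + 1))) ≤ ε / 2 := by
    rw [mul_div_assoc', div_le_div_iff₀ (by positivity) (by positivity)]
    nlinarith
  have j1 := mul_le_mul_of_nonneg_left i1 hc
  have j2 := mul_le_mul_of_nonneg_left i2 hc
  have j3 := mul_le_mul_of_nonneg_left h3 hc
  obtain ⟨N1, hN1⟩ := Metric.tendsto_atTop.1 hφ.2 (ε/2) (by positivity)
  obtain ⟨N2, hN2⟩ := Metric.tendsto_atTop.1 hψ.2 (ε/2) (by positivity)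
  refine ⟨max N1 N2, fun n hn => ?_⟩
  have k1 := (abs_lt.1 (Real.dist_eq _ _ ▸ hN1 n (le_of_max_le_left hn))).1
  have k2 := (abs_lt.1 (Real.dist_eq _ _ ▸ hN2 n (le_of_max_le_right hn))).2
  have l1 : ∑ k ∈ S n, w n k * φ (x n k) ≤ ∑ k ∈ S n, w n k * f (x n k) :=
    Finset.sum_le_sum fun k hk => mul_le_mul_of_nonneg_left (h1 _ (hx n k hk)) (hw n k hk)
  have l2 : ∑ k ∈ S n, w n k * f (x n k) ≤ ∑ k ∈ S n, w n k * ψ (x n k) :=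
    Finset.sum_le_sum fun k hk => mul_le_mul_of_nonneg_left (h2 _ (hx n k hk)) (hw n k hk)
  rw [Real.dist_eq, abs_lt]
  constructor <;> linarith

/-- Closure under uniform approximation on `[a,b]`. -/
lemma GoodFn.unif (hab : a ≤ b) (hc : 0 ≤ c) (hw : ∀ n, ∀ k ∈ S n, 0 ≤ w n k)
    (hx : ∀ n, ∀ k ∈ S n, x n k ∈ Set.Icc a b) (hf : IntervalIntegrable f volume a b)
    (h1 : GoodFn a b c S w x (fun _ => 1))
    (h : ∀ ε > 0, ∃ φ, GoodFn a b c S w x φ ∧ (∀ t ∈ Set.Icc a b, |φ t - f t| ≤ ε)) :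
    GoodFn a b c S w x f := by
  refine GoodFn.sandwich hab hc hw hx hf fun ε hε => ?_
  have hd : 0 < 2 * (b - a + 1) := by linarith
  set η := ε / (2 * (b - a + 1)) with hη
  have hη0 : 0 < η := by positivity
  obtain ⟨φ, hφ, hb⟩ := h η hη0
  have g1 := hφ.add (h1.smul (-η))
  have g2 := hφ.add (h1.smul η)
  refine ⟨_, _, g1, g2, ?_, ?_, ?_⟩
  · intro t ht
    have := abs_le.1 (hb t ht)
    linarith
  · intro t ht
    have := abs_le.1 (hb t ht)
    linarith
  · rw [intervalIntegral.integral_add hφ.1 intervalIntegrable_const,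
      intervalIntegral.integral_add hφ.1 intervalIntegrable_const]
    simp only [intervalIntegral.integral_const, smul_eq_mul]
    have : η * (2 * (b - a + 1)) = ε := by exact div_mul_cancel₀ _ hd.ne'
    nlinarith

lemma RiemannIntegrableOn.neg (hf : RiemannIntegrableOn f a b) :
    RiemannIntegrableOn (fun t => - f t) a b := by
  obtain ⟨⟨M, hM⟩, h⟩ := hf
  refine ⟨⟨M, fun x hx => by simpa using hM x hx⟩, ?_⟩
  filter_upwards [h] with x hx using hx.neg

lemma GoodFn.riemann (hab : a ≤ b) (hc : 0 ≤ c) (hw : ∀ n, ∀ k ∈ S n, 0 ≤ w n k)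
    (hx : ∀ n, ∀ k ∈ S n, x n k ∈ Set.Icc a b) (hf : RiemannIntegrableOn f a b)
    (h : ∀ ψ : ℝ → ℝ, UniformContinuous ψ → ψ a = ψ b → GoodFn a b c S w x ψ) :
    GoodFn a b c S w x f := by
  obtain ⟨hi, h1⟩ := riemann_approx hab hf
  obtain ⟨hi', h2⟩ := riemann_approx hab hf.neg
  refine GoodFn.sandwich hab hc hw hx hi fun ε hε => ?_
  obtain ⟨ψ, u1, u2, u3, u4⟩ := h1 (ε/2) (by positivity)
  obtain ⟨φ, v1, v2, v3, v4⟩ := h2 (ε/2) (by positivity)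
  refine ⟨fun t => (-1) * φ t, ψ, (h φ v1 v2).smul (-1), h ψ u1 u2, ?_, u3, ?_⟩
  · intro t ht
    have := v3 t ht
    linarith
  · rw [intervalIntegral.integral_const_mul]
    rw [intervalIntegral.integral_neg] at v4
    linarith

lemma integral_indicator_one (hab : a ≤ b) {J : Set ℝ} (hJ : J.OrdConnected)
    (hJs : J ⊆ Set.Icc a b) :
    IntervalIntegrable (J.indicator (fun _ => (1:ℝ))) volume a b ∧
    ∫ t in a..b, J.indicator (fun _ => (1:ℝ)) t = (volume J).toReal := by
  have hm := hJ.measurableSet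
  have hfin : volume J ≠ ⊤ := (measure_mono hJs).trans_lt (by simp) |>.ne
  have hI : Integrable (J.indicator (fun _ => (1:ℝ))) volume :=
    (integrable_indicator_iff hm).2 (integrableOn_const hfin)
  refine ⟨hI.intervalIntegrable, ?_⟩
  rw [intervalIntegral.integral_of_le hab, ← integral_Icc_eq_integral_Ioc,
    setIntegral_indicator hm, Set.inter_eq_self_of_subset_right hJs]
  simp [Measure.real]

lemma GoodFn.of_intervals (hab : a ≤ b) (hc : 0 ≤ c) (hw : ∀ n, ∀ k ∈ S n, 0 ≤ w n k)
    (hx : ∀ n, ∀ k ∈ S n, x n k ∈ Set.Icc a b)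
    (h : ∀ J : Set ℝ, J.OrdConnected → J ⊆ Set.Icc a b →
      Tendsto (fun n => ∑ k ∈ S n, w n k * J.indicator (fun _ => (1:ℝ)) (x n k)) atTop
        (𝓝 (c * (volume J).toReal)))
    (hf : RiemannIntegrableOn f a b) : GoodFn a b c S w x f := by
  have hJ : ∀ J : Set ℝ, J.OrdConnected → J ⊆ Set.Icc a b →
      GoodFn a b c S w x (J.indicator (fun _ => (1:ℝ))) := by
    intro J h1 h2
    obtain ⟨h3, h4⟩ := integral_indicator_one hab h1 h2
    refine ⟨h3, ?_⟩
    rw [h4]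
    exact h J h1 h2
  have hone : GoodFn a b c S w x (fun _ => 1) := by
    obtain ⟨h3, h4⟩ := hJ (Set.Icc a b) Set.ordConnected_Icc le_rfl
    refine ⟨intervalIntegrable_const, ?_⟩
    rw [(integral_indicator_one hab Set.ordConnected_Icc le_rfl).2] at h4
    have e : ∫ t in a..b, (1:ℝ) = (volume (Set.Icc a b)).toReal := by simp [hab]
    rw [e]
    refine h4.congr fun n => Finset.sum_congr rfl fun k hk => ?_
    rw [Set.indicator_of_mem (hx n k hk)]
  refine GoodFn.riemann hab hc hw hx hf fun ψ hψ _ => ?_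
  refine GoodFn.unif hab hc hw hx (hψ.continuous.intervalIntegrable _ _) hone fun ε hε => ?_
  obtain ⟨δ, hδ, hd⟩ := Metric.uniformContinuous_iff.1 hψ ε hε
  set η := δ / 2 with hη
  have hη0 : 0 < η := by positivity
  let J : ℤ → Set ℝ := fun i => Set.Icc a b ∩ {t | ⌊t / η⌋ = i}
  have hmono : Monotone fun t : ℝ => ⌊t / η⌋ := fun s t hst =>
    Int.floor_le_floor (div_le_div_of_nonneg_right hst hη0.le)
  refine ⟨fun t => ∑ i ∈ Finset.Icc ⌊a / η⌋ ⌊b / η⌋,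
    ψ (i * η) * (J i).indicator (fun _ => (1:ℝ)) t, ?_, ?_⟩
  · refine GoodFn.sum _ _ fun i _ => (hJ (J i) ?_ Set.inter_subset_left).smul _
    refine Set.ordConnected_Icc.inter ⟨fun s hs t ht u hu => ?_⟩
    have h1 := hmono hu.1
    have h2 := hmono hu.2
    simp only [Set.mem_ofPred_eq] at *
    omega
  · intro t ht
    have : ∑ i ∈ Finset.Icc ⌊a / η⌋ ⌊b / η⌋, ψ (i * η) * (J i).indicator (fun _ => (1:ℝ)) t
        = ψ (⌊t / η⌋ * η) := by
      rw [Finset.sum_eq_single ⌊t / η⌋]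
      · rw [Set.indicator_of_mem (show t ∈ J ⌊t / η⌋ from ⟨ht, rfl⟩), mul_one]
      · intro i _ hi
        rw [Set.indicator_of_notMem, mul_zero]
        rintro ⟨_, h'⟩
        exact hi h'.symm
      · intro hn
        exact absurd (Finset.mem_Icc.2 ⟨hmono ht.1, hmono ht.2⟩) hn
    simp only [this]
    rw [← Real.dist_eq]
    refine (hd ?_).le
    rw [Real.dist_eq, abs_lt]
    have f1 := Int.floor_le (t / η)
    have f2 := Int.lt_floor_add_one (t / η)
    rw [le_div_iff₀ hη0] at f1
    rw [div_lt_iff₀ hη0] at f2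
    constructor <;> nlinarith

end Good

lemma idx_eq_filter {A B : ℝ} {J : Set ℝ} (hJ : J ⊆ Set.Icc A B) (n : ℕ) :
    idxFinset A B n J = (idxFinset A B n (Set.Icc A B)).filter fun k : ℤ => (k : ℝ) / n ∈ J := by
  ext k
  simp only [idxFinset, Finset.mem_filter]
  exact ⟨fun h => ⟨⟨h.1, hJ h.2⟩, h.2⟩, fun h => ⟨h.1.1, h.2⟩⟩

lemma mem_idx {A B : ℝ} {n : ℕ} {k : ℤ} (hk : k ∈ idxFinset A B n (Set.Icc A B)) :
    (k:ℝ) / n ∈ Set.Icc A B := by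
  simp only [idxFinset, Finset.mem_filter] at hk
  exact hk.2

lemma sum_idx {A B : ℝ} {J : Set ℝ} (hJ : J ⊆ Set.Icc A B) (n : ℕ) (F : ℤ → ℝ) :
    1 / (n:ℝ) * ∑ k ∈ idxFinset A B n J, F k =
      ∑ k ∈ idxFinset A B n (Set.Icc A B),
        (1 / (n:ℝ) * J.indicator (fun _ => (1:ℝ)) ((k:ℝ) / n)) * F k := by
  rw [idx_eq_filter hJ, Finset.sum_filter, Finset.mul_sum]
  refine Finset.sum_congr rfl fun k _ => ?_
  by_cases h : (k:ℝ) / n ∈ J <;> simp [h]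

lemma card_idx {A B : ℝ} {I J : Set ℝ} (hJ : J ⊆ Set.Icc A B) (n : ℕ) (s : ℕ → ℤ → ℝ) :
    (((idxFinset A B n J).filter fun k : ℤ => s n k ∈ I).card : ℝ) / n =
      ∑ k ∈ idxFinset A B n (Set.Icc A B),
        (1 / (n:ℝ) * J.indicator (fun _ => (1:ℝ)) ((k:ℝ) / n)) *
          I.indicator (fun _ => (1:ℝ)) (s n k) := by
  rw [← sum_idx hJ, Finset.card_filter, div_eq_mul_one_div, mul_comm]
  push_cast
  congr 1

lemma count_tendsto {A B : ℝ} {J : Set ℝ} (hJ : J.OrdConnected) (hJs : J ⊆ Set.Icc A B) :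
    Tendsto (fun n : ℕ => ((idxFinset A B n J).card : ℝ) / n) atTop
      (𝓝 (volume J).toReal) := by
  rcases J.eq_empty_or_nonempty with rfl | hne
  · simp [idxFinset]
  have hbb : BddBelow J := ⟨A, fun x hx => (hJs hx).1⟩
  have hba : BddAbove J := ⟨B, fun x hx => (hJs hx).2⟩
  set l := sInf J with hl
  set u := sSup J with hu
  have hlu : l ≤ u := Real.sInf_le_sSup J hbb hba
  have h1 : Set.Ioo l u ⊆ J := by
    intro x hx
    obtain ⟨y, hy, hyx⟩ := exists_lt_of_csInf_lt hne hx.1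
    obtain ⟨z, hz, hxz⟩ := exists_lt_of_lt_csSup hne hx.2
    exact hJ.out hy hz ⟨hyx.le, hxz.le⟩
  have h2 : J ⊆ Set.Icc l u := fun x hx => ⟨csInf_le hbb hx, le_csSup hba hx⟩
  have hvol : (volume J).toReal = u - l := by
    have a1 := measure_mono (μ := volume) h1
    have a2 := measure_mono (μ := volume) h2
    rw [Real.volume_Ioo] at a1
    rw [Real.volume_Icc] at a2
    rw [le_antisymm a2 a1, ENNReal.toReal_ofReal (by linarith)]
  rw [hvol]
  have t : Tendsto (fun n : ℕ => (1:ℝ) / n) atTop (𝓝 0) := tendsto_one_div_atTop_nhds_zero_nat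
  have tlo : Tendsto (fun n : ℕ => (u - l) - (1:ℝ) / n) atTop (𝓝 (u - l)) := by
    simpa using t.const_sub (u - l)
  have thi : Tendsto (fun n : ℕ => (u - l) + (1:ℝ) / n) atTop (𝓝 (u - l)) := by
    simpa using t.const_add (u - l)
  refine tendsto_of_tendsto_of_tendsto_of_le_of_le' tlo thi ?_ ?_
  · filter_upwards [eventually_gt_atTop 0] with n hn
    have hn' : (0:ℝ) < n := by exact_mod_cast hn
    have hsub : Finset.Ioo ⌊l * n⌋ ⌈u * n⌉ ⊆ idxFinset A B n J := by
      intro k hk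
      rw [Finset.mem_Ioo, Int.floor_lt, Int.lt_ceil] at hk
      have hkJ : (k:ℝ) / n ∈ J := h1 ⟨(lt_div_iff₀ hn').2 hk.1, (div_lt_iff₀ hn').2 hk.2⟩
      have hkI := hJs hkJ
      refine Finset.mem_filter.2 ⟨Finset.mem_Icc.2 ⟨?_, ?_⟩, hkJ⟩
      · exact Int.ceil_le.2 ((le_div_iff₀ hn').1 hkI.1)
      · exact Int.le_floor.2 ((div_le_iff₀ hn').1 hkI.2)
    have hc := Finset.card_le_card hsub
    rw [Int.card_Ioo] at hc
    have hc2 : (⌈u * n⌉ - ⌊l * n⌋ - 1 : ℤ) ≤ ((idxFinset A B n J).card : ℤ) :=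
      (Int.self_le_toNat _).trans (by exact_mod_cast hc)
    have hc3 : ((⌈u * n⌉:ℝ) - ⌊l * n⌋ - 1) ≤ ((idxFinset A B n J).card : ℝ) := by
      exact_mod_cast hc2
    have c1 := Int.le_ceil (u * n)
    have c2 := Int.floor_le (l * n)
    rw [le_div_iff₀ hn', sub_mul, one_div, inv_mul_cancel₀ hn'.ne']
    linarith
  · filter_upwards [eventually_gt_atTop 0] with n hn
    have hn' : (0:ℝ) < n := by exact_mod_cast hn
    have hsub : idxFinset A B n J ⊆ Finset.Icc ⌈l * n⌉ ⌊u * n⌋ := by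
      intro k hk
      have hkJ := h2 (Finset.mem_filter.1 hk).2
      refine Finset.mem_Icc.2 ⟨?_, ?_⟩
      · exact Int.ceil_le.2 ((le_div_iff₀ hn').1 hkJ.1)
      · exact Int.le_floor.2 ((div_le_iff₀ hn').1 hkJ.2)
    have hc := Finset.card_le_card hsub
    rw [Int.card_Icc] at hc
    have c1 := Int.floor_le (u * n)
    have c2 := Int.le_ceil (l * n)
    have hln : l * n ≤ u * n := mul_le_mul_of_nonneg_right hlu hn'.le
    have hc0 : (0:ℤ) ≤ ⌊u * n⌋ + 1 - ⌈l * n⌉ := by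
      have := Int.ceil_lt_add_one (l * n)
      have h3 := Int.lt_floor_add_one (u * n)
      have : (⌈l * n⌉ : ℝ) < ⌊u * n⌋ + 1 + 1 := by linarith
      have : ⌈l * n⌉ < ⌊u * n⌋ + 1 + 1 := by exact_mod_cast this
      omega
    have hc2 : ((idxFinset A B n J).card : ℤ) ≤ ⌊u * n⌋ + 1 - ⌈l * n⌉ := by
      omega
    have hc3 : ((idxFinset A B n J).card : ℝ) ≤ ⌊u * n⌋ + 1 - ⌈l * n⌉ := by
      exact_mod_cast hc2
    rw [div_le_iff₀ hn', add_mul, one_div, inv_mul_cancel₀ hn'.ne']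
    linarith

lemma RiemannIntegrableOn.add_const {f : ℝ → ℝ} {a b : ℝ} (hf : RiemannIntegrableOn f a b)
    (r : ℝ) : RiemannIntegrableOn (fun t => f t + r) a b := by
  obtain ⟨⟨M, hM⟩, h⟩ := hf
  refine ⟨⟨M + |r|, fun x hx => (abs_add_le _ _).trans (by have := hM x hx; linarith)⟩, ?_⟩
  filter_upwards [h] with x hx using hx.add continuousWithinAt_const

lemma RiemannIntegrableOn.of_continuous {f : ℝ → ℝ} (a b : ℝ) (hf : Continuous f) :
    RiemannIntegrableOn f a b := by
  obtain ⟨M, hM⟩ := isCompact_Icc.exists_bound_of_continuousOn (s := Set.Icc a b) hf.continuousOn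
  exact ⟨⟨M, hM⟩, Eventually.of_forall fun x => hf.continuousWithinAt⟩

lemma RiemannIntegrableOn.indicator {J : Set ℝ} (hJ : J.OrdConnected) (a b : ℝ) :
    RiemannIntegrableOn (J.indicator fun _ => (1:ℝ)) a b := by
  refine ⟨⟨1, fun x _ => ?_⟩, ?_⟩
  · by_cases h : x ∈ J <;> simp [h]
  · have h0 : volume (frontier J) = 0 := hJ.convex.addHaar_frontier volume
    refine ae_restrict_of_ae ?_
    filter_upwards [measure_eq_zero_iff_ae_notMem.1 h0] with x hx
    refine ContinuousAt.continuousWithinAt ?_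
    by_contra hcon
    refine hx ?_
    rw [frontier_eq_closure_inter_closure]
    by_contra h2
    apply hcon
    rw [Set.mem_inter_iff, not_and_or, mem_closure_iff_nhds, mem_closure_iff_nhds] at h2
    push Not at h2
    rcases h2 with ⟨t, ht, h⟩ | ⟨t, ht, h⟩
    · refine (continuousAt_const (y := (0:ℝ))).congr ?_
      filter_upwards [ht] with y hy
      rw [Set.indicator_of_notMem]
      intro hyJ
      exact (h ▸ (⟨hy, hyJ⟩ : y ∈ t ∩ J) : y ∈ (∅ : Set ℝ))
    · refine (continuousAt_const (y := (1:ℝ))).congr ?_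
      filter_upwards [ht] with y hy
      rw [Set.indicator_of_mem]
      by_contra hyJ
      exact (h ▸ (⟨hy, hyJ⟩ : y ∈ t ∩ Jᶜ) : y ∈ (∅ : Set ℝ))

section Main
variable {A B : ℝ} {s : ℕ → ℤ → ℝ}

lemma condC_of_aux (hAB : A ≤ B)
    (hs : ∀ n : ℕ, ∀ k : ℤ, (k : ℝ) / n ∈ Set.Icc A B → s n k ∈ Set.Icc (0:ℝ) 1)
    (h : ∀ J : Set ℝ, J.OrdConnected → J ⊆ Set.Icc A B → ∀ g, RiemannIntegrableOn g 0 1 →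
      Tendsto (fun n : ℕ => ∑ k ∈ idxFinset A B n (Set.Icc A B),
        (1 / (n:ℝ) * J.indicator (fun _ => (1:ℝ)) ((k:ℝ) / n)) * g (s n k)) atTop
        (𝓝 ((volume J).toReal * ∫ t in (0:ℝ)..1, g t))) : CondC A B s := by
  have key : ∀ f g : ℝ → ℝ, RiemannIntegrableOn f A B → RiemannIntegrableOn g 0 1 →
      (∀ t ∈ Set.Icc (0:ℝ) 1, 0 ≤ g t) → Tendsto
      (fun n : ℕ => (1 / (n : ℝ)) *
        ∑ k ∈ idxFinset A B n (Set.Icc A B), f ((k : ℝ) / n) * g (s n k))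
      atTop (nhds ((∫ x in A..B, f x) * ∫ x in (0:ℝ)..1, g x)) := by
    intro f g hf hg hg0
    have := GoodFn.of_intervals (c := ∫ x in (0:ℝ)..1, g x)
      (S := fun n => idxFinset A B n (Set.Icc A B))
      (w := fun n k => 1 / (n:ℝ) * g (s n k)) (x := fun n k => (k:ℝ) / n) hAB
      (intervalIntegral.integral_nonneg zero_le_one hg0)
      (fun n k hk => mul_nonneg (by positivity) (hg0 _ (hs n k (mem_idx hk))))
      (fun n k hk => mem_idx hk) ?_ hf
    · have h2 := this.2
      rw [mul_comm] at h2
      refine h2.congr fun n => ?_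
      rw [Finset.mul_sum]
      exact Finset.sum_congr rfl fun k _ => by ring
    · intro J hJ hJs
      have := h J hJ hJs g hg
      rw [mul_comm] at this
      refine this.congr fun n => ?_
      exact Finset.sum_congr rfl fun k _ => by ring
  intro f g hf hg
  obtain ⟨M, hM⟩ := hg.1
  have hM0 : 0 ≤ M := (abs_nonneg _).trans (hM 0 (by simp))
  have gi := (riemann_approx zero_le_one hg).1
  have k1 := key f (fun t => g t + M) hf (hg.add_const M)
    (fun t ht => by have := (abs_le.1 (hM t ht)).1; linarith)
  have k2 := key f (fun _ => M) hf (RiemannIntegrableOn.of_continuous 0 1 continuous_const)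
    (fun t ht => hM0)
  have k3 := k1.sub k2
  rw [intervalIntegral.integral_add gi intervalIntegrable_const, ← mul_sub,
    add_sub_cancel_right] at k3
  refine k3.congr fun n => ?_
  rw [← mul_sub, ← Finset.sum_sub_distrib]
  congr 1
  exact Finset.sum_congr rfl fun k _ => by ring

lemma weight_nonneg (J : Set ℝ) (n : ℕ) (t : ℝ) :
    0 ≤ 1 / (n:ℝ) * J.indicator (fun _ => (1:ℝ)) t :=
  mul_nonneg (by positivity) (Set.indicator_nonneg (fun _ _ => zero_le_one) _)

lemma condC_of_condA (hAB : A ≤ B)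
    (hs : ∀ n : ℕ, ∀ k : ℤ, (k : ℝ) / n ∈ Set.Icc A B → s n k ∈ Set.Icc (0:ℝ) 1)
    (h : CondA A B s) : CondC A B s := by
  refine condC_of_aux hAB hs fun J hJ hJs g hg => ?_
  refine (GoodFn.of_intervals zero_le_one ENNReal.toReal_nonneg
    (S := fun n => idxFinset A B n (Set.Icc A B))
    (w := fun n k => 1 / (n:ℝ) * J.indicator (fun _ => (1:ℝ)) ((k:ℝ) / n))
    (fun n k _ => weight_nonneg _ _ _) (fun n k hk => hs n k (mem_idx hk)) ?_ hg).2
  intro I hI hIs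
  have := h I J hI hJ hIs hJs
  rw [mul_comm] at this
  exact this.congr fun n => card_idx hJs n s

lemma condA_of_condC (hAB : A ≤ B) (h : CondC A B s) : CondA A B s := by
  intro I J hI hJ hIs hJs
  have := h _ _ (RiemannIntegrableOn.indicator hJ A B) (RiemannIntegrableOn.indicator hI 0 1)
  rw [(integral_indicator_one hAB hJ hJs).2, (integral_indicator_one zero_le_one hI hIs).2,
    mul_comm] at this
  refine this.congr fun n => ?_
  rw [card_idx hJs, Finset.mul_sum]
  exact Finset.sum_congr rfl fun k _ => by ring

lemma re_aux (x y : ℝ) : ((x : ℂ) + (y : ℂ) * Complex.I).re = x := by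
  simp

lemma im_aux (x y : ℝ) : ((x : ℂ) + (y : ℂ) * Complex.I).im = y := by
  simp

lemma exp_eq (j : ℤ) (t : ℝ) : Complex.exp (2 * Real.pi * Complex.I * (j : ℂ) * (t : ℂ)) =
    (Real.cos (2 * π * j * t) : ℂ) + (Real.sin (2 * π * j * t) : ℂ) * Complex.I := by
  rw [Complex.ofReal_cos, Complex.ofReal_sin, ← Complex.exp_mul_I]
  push_cast
  congr 1
  ring

lemma integral_cos_zero {j : ℤ} (hj : j ≠ 0) :
    ∫ t in (0:ℝ)..1, Real.cos (2 * π * j * t) = 0 := by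
  have hj' : (2 * π * j : ℝ) ≠ 0 := by
    have : (j:ℝ) ≠ 0 := by exact_mod_cast hj
    positivity
  rw [intervalIntegral.integral_comp_mul_left (fun t => Real.cos t) hj', integral_cos]
  have : Real.sin (2 * π * j) = 0 := by
    rw [show (2 * π * j : ℝ) = ((2 * j : ℤ) : ℝ) * π by push_cast; ring]
    exact Real.sin_int_mul_pi _
  simp [this]

lemma integral_sin_zero {j : ℤ} (hj : j ≠ 0) :
    ∫ t in (0:ℝ)..1, Real.sin (2 * π * j * t) = 0 := by
  have hj' : (2 * π * j : ℝ) ≠ 0 := by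
    have : (j:ℝ) ≠ 0 := by exact_mod_cast hj
    positivity
  rw [intervalIntegral.integral_comp_mul_left (fun t => Real.sin t) hj', integral_sin]
  have : Real.cos (2 * π * j) = 1 := by
    rw [show (2 * π * j : ℝ) = (j : ℝ) * (2 * π) by ring]
    exact Real.cos_int_mul_two_pi _
  simp [this]

lemma weyl_eq (j : ℤ) (n : ℕ) (T : Finset ℤ) :
    (1 / (n : ℂ)) * ∑ k ∈ T, Complex.exp (2 * Real.pi * Complex.I * (j : ℂ) * (s n k : ℂ)) =
    ((1 / (n:ℝ) * ∑ k ∈ T, Real.cos (2 * π * j * s n k) : ℝ) : ℂ) +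
    ((1 / (n:ℝ) * ∑ k ∈ T, Real.sin (2 * π * j * s n k) : ℝ) : ℂ) * Complex.I := by
  simp only [exp_eq, Finset.sum_add_distrib, ← Finset.sum_mul]
  push_cast
  ring

lemma condB_of_condC (h : CondC A B s) : CondB A B s := by
  intro j hj J hJ hJs
  have hc := h _ (fun t => Real.cos (2 * π * j * t)) (RiemannIntegrableOn.indicator hJ A B)
    (RiemannIntegrableOn.of_continuous 0 1 (by fun_prop))
  have hsn := h _ (fun t => Real.sin (2 * π * j * t)) (RiemannIntegrableOn.indicator hJ A B)
    (RiemannIntegrableOn.of_continuous 0 1 (by fun_prop))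
  rw [integral_cos_zero hj, mul_zero] at hc
  rw [integral_sin_zero hj, mul_zero] at hsn
  have hcC := (Complex.continuous_ofReal.tendsto 0).comp hc
  have hsC := (Complex.continuous_ofReal.tendsto 0).comp hsn
  have := hcC.add (hsC.mul_const Complex.I)
  simp only [Complex.ofReal_zero, zero_mul, add_zero] at this
  refine this.congr fun n => ?_
  rw [weyl_eq, sum_idx hJs, sum_idx hJs]
  simp only [Function.comp, Finset.mul_sum, mul_assoc]

lemma condC_of_condB (hAB : A ≤ B)
    (hs : ∀ n : ℕ, ∀ k : ℤ, (k : ℝ) / n ∈ Set.Icc A B → s n k ∈ Set.Icc (0:ℝ) 1)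
    (h : CondB A B s) : CondC A B s := by
  refine condC_of_aux hAB hs fun J hJ hJs g hg => ?_
  set S : ℕ → Finset ℤ := fun n => idxFinset A B n (Set.Icc A B) with hS
  set w : ℕ → ℤ → ℝ := fun n k => 1 / (n:ℝ) * J.indicator (fun _ => (1:ℝ)) ((k:ℝ) / n) with hwd
  set c := (volume J).toReal with hcd
  have hw : ∀ n, ∀ k ∈ S n, 0 ≤ w n k := fun n k _ => weight_nonneg _ _ _
  have hx : ∀ n, ∀ k ∈ S n, s n k ∈ Set.Icc (0:ℝ) 1 := fun n k hk => hs n k (mem_idx hk)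
  have hc : 0 ≤ c := ENNReal.toReal_nonneg
  have hone : GoodFn 0 1 c S w s (fun _ => 1) := by
    refine ⟨intervalIntegrable_const, ?_⟩
    simp only [intervalIntegral.integral_const, sub_zero, smul_eq_mul, mul_one]
    refine (count_tendsto hJ hJs).congr fun n => ?_
    have := sum_idx hJs n (fun _ => 1)
    simp only [mul_one] at this
    rw [hS, hwd]
    simp only
    rw [← this]
    simp [div_eq_inv_mul]
  have hcos : ∀ j : ℤ, GoodFn 0 1 c S w s (fun t => Real.cos (2 * π * j * t)) := by
    intro j
    rcases eq_or_ne j 0 with rfl | hj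
    · simpa using hone
    refine ⟨Continuous.intervalIntegrable (by fun_prop) _ _, ?_⟩
    rw [integral_cos_zero hj, mul_zero]
    have := (Complex.continuous_re.tendsto 0).comp (h j hj J hJ hJs)
    refine this.congr fun n => ?_
    simp only [Function.comp]
    rw [weyl_eq, re_aux, sum_idx hJs]
  have hsin : ∀ j : ℤ, GoodFn 0 1 c S w s (fun t => Real.sin (2 * π * j * t)) := by
    intro j
    rcases eq_or_ne j 0 with rfl | hj
    · simpa using GoodFn.zero
    refine ⟨Continuous.intervalIntegrable (by fun_prop) _ _, ?_⟩
    rw [integral_sin_zero hj, mul_zero]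
    have := (Complex.continuous_im.tendsto 0).comp (h j hj J hJ hJs)
    refine this.congr fun n => ?_
    simp only [Function.comp]
    rw [weyl_eq, im_aux, sum_idx hJs]
  have hspan : ∀ p ∈ Submodule.span ℂ (Set.range (@fourier 1)),
      GoodFn 0 1 c S w s (fun t => (p (t : AddCircle (1:ℝ))).re) ∧
      GoodFn 0 1 c S w s (fun t => (p (t : AddCircle (1:ℝ))).im) := by
    intro p hp
    induction hp using Submodule.span_induction with
    | mem p hp =>
      obtain ⟨j, rfl⟩ := hp
      have e : ∀ t : ℝ, fourier j (t : AddCircle (1:ℝ)) =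
          (Real.cos (2 * π * j * t) : ℂ) + (Real.sin (2 * π * j * t) : ℂ) * Complex.I := by
        intro t
        rw [fourier_coe_apply, ← exp_eq]
        simp
      simp only [e, re_aux, im_aux]
      exact ⟨hcos j, hsin j⟩
    | zero => exact ⟨by simpa using GoodFn.zero, by simpa using GoodFn.zero⟩
    | add p q _ _ hp hq => exact ⟨by simpa using hp.1.add hq.1, by simpa using hp.2.add hq.2⟩
    | smul z p _ hp =>
      refine ⟨?_, ?_⟩
      · simpa [sub_eq_add_neg] using (hp.1.smul z.re).add (hp.2.smul (-z.im))
      · simpa using (hp.2.smul z.re).add (hp.1.smul z.im)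
  refine (GoodFn.riemann zero_le_one hc hw hx hg fun ψ hψ h01 => ?_).2
  refine GoodFn.unif zero_le_one hc hw hx (hψ.continuous.intervalIntegrable _ _) hone
    fun ε hε => ?_
  have hcont : Continuous (AddCircle.liftIco (1:ℝ) 0 (fun t => (ψ t : ℂ))) := by
    refine AddCircle.liftIco_zero_continuous (by simp [h01]) ?_
    exact (Complex.continuous_ofReal.comp hψ.continuous).continuousOn
  let Ψ : C(AddCircle (1:ℝ), ℂ) := ⟨_, hcont⟩
  have hΨ : ∀ t ∈ Set.Icc (0:ℝ) 1, Ψ (t : AddCircle (1:ℝ)) = ψ t := by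
    intro t ht
    rcases eq_or_lt_of_le ht.2 with rfl | hlt
    · have : ((1:ℝ) : AddCircle (1:ℝ)) = ((0:ℝ) : AddCircle (1:ℝ)) := by
        rw [AddCircle.coe_period]; rfl
      rw [this, ← h01]
      exact AddCircle.liftIco_zero_coe_apply (f := fun t => (ψ t : ℂ)) (x := (0:ℝ)) (by simp)
    · exact AddCircle.liftIco_zero_coe_apply (f := fun t => (ψ t : ℂ)) ⟨ht.1, hlt⟩
  have hmem : Ψ ∈ (Submodule.span ℂ (Set.range (@fourier 1))).topologicalClosure := by
    rw [span_fourier_closure_eq_top]; trivial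
  obtain ⟨p, hp, hpd⟩ := Metric.mem_closure_iff.1 hmem ε hε
  refine ⟨_, (hspan p hp).1, fun t ht => ?_⟩
  have h1 : ‖(p - Ψ) (t : AddCircle (1:ℝ))‖ ≤ ‖p - Ψ‖ := ContinuousMap.norm_coe_le_norm _ _
  rw [← dist_eq_norm, dist_comm] at h1
  have h2 := Complex.abs_re_le_norm ((p - Ψ) (t : AddCircle (1:ℝ)))
  rw [ContinuousMap.sub_apply, hΨ t ht, Complex.sub_re, Complex.ofReal_re] at h2
  rw [ContinuousMap.sub_apply, hΨ t ht] at h1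
  linarith

end Main

/-- Lemma 3: the three equidistribution conditions (a), (b), (c) are equivalent. -/
theorem equidistribution_conditions_equivalent
    (A B : ℝ) (hAB : A ≤ B) (s : ℕ → ℤ → ℝ)
    (hs : ∀ n : ℕ, ∀ k : ℤ, (k : ℝ) / n ∈ Set.Icc A B → s n k ∈ Set.Icc (0:ℝ) 1) :
    (CondA A B s ↔ CondB A B s) ∧ (CondB A B s ↔ CondC A B s) := by
  have hBC : CondB A B s ↔ CondC A B s :=
    ⟨condC_of_condB hAB hs, condB_of_condC⟩
  exact ⟨⟨fun h => condB_of_condC (condC_of_condA hAB hs h),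
    fun h => condA_of_condC hAB (hBC.1 h)⟩, hBC⟩
end

section
/- Let φ be a real-valued twice differentiable function on a compact interval J₀ = [A, B] with φ''(x) ≥ ρ > 0 for all x ∈ J₀. Then the array ⟨n φ(k/n)⟩ (the fractional parts of n φ(k/n)), for n = 1, 2, … and integers k with k/n ∈ J₀, is equidistributed on [0, 1]; that is, for every pair of intervals I ⊆ [0, 1] and J ⊆ J₀, (1/n) · #{k ∈ ℤ : k/n ∈ J and ⟨n φ(k/n)⟩ ∈ I} → |I|·|J| as n → ∞, where |I| and |J| denote the lengths of I and J. -/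
open MeasureTheory Filter Set
open scoped Real Topology Classical

/-- The additive character `e(x) = exp(2 π i x)`. -/
noncomputable def ee (x : ℝ) : ℂ := Complex.exp (Complex.I * ((2 * π * x : ℝ) : ℂ))

lemma ee_norm (x : ℝ) : ‖ee x‖ = 1 := by
  unfold ee
  rw [mul_comm]
  exact Complex.norm_exp_ofReal_mul_I _

lemma ee_add (x y : ℝ) : ee (x + y) = ee x * ee y := by
  unfold ee
  rw [← Complex.exp_add]
  congr 1
  push_cast
  ring

lemma ee_int (m : ℤ) : ee m = 1 := by
  unfold ee
  rw [Complex.exp_eq_one_iff]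
  exact ⟨m, by push_cast; ring⟩

lemma ee_zero : ee 0 = 1 := by simpa using ee_int 0

lemma ee_nat_mul (j : ℕ) (x : ℝ) : ee (j * x) = ee x ^ j := by
  unfold ee
  rw [← Complex.exp_nat_mul]
  congr 1
  push_cast
  ring

lemma ee_lip (x y : ℝ) : ‖ee x - ee y‖ ≤ 2 * π * |x - y| := by
  have h : ee x - ee y = ee y * (ee (x - y) - 1) := by
    rw [mul_sub, ← ee_add, mul_one]
    congr 2
    ring
  rw [h, norm_mul, ee_norm, one_mul]
  have := Real.norm_exp_I_mul_ofReal_sub_one_le (x := 2 * π * (x - y))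
  unfold ee
  refine this.trans ?_
  rw [Real.norm_eq_abs, abs_mul, abs_of_pos (by positivity : 0 < 2 * π)]

lemma ee_lower (x : ℝ) : 4 * |x - round x| ≤ ‖ee x - 1‖ := by
  have h : ee x = ee (x - round x) := by
    have : ee x = ee ((x - round x) + round x) := by congr 1; ring
    rw [this, ee_add, ee_int, mul_one]
  rw [h]
  set t := x - round x with ht
  have ht2 : |t| ≤ 1 / 2 := abs_sub_round x
  unfold ee
  rw [Complex.norm_exp_I_mul_ofReal_sub_one, Real.norm_eq_abs, abs_mul]
  have h2 : 2 * π * t / 2 = π * t := by ring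
  rw [h2]
  have h3 := Real.mul_abs_le_abs_sin (x := π * t) (by
    rw [abs_mul, abs_of_pos Real.pi_pos]
    nlinarith [Real.pi_pos])
  rw [abs_mul, abs_of_pos Real.pi_pos] at h3
  have h4 : 2 / π * (π * |t|) = 2 * |t| := by field_simp
  rw [h4] at h3
  norm_num
  linarith

lemma ee_geom (L : ℕ) (x δ : ℝ) (hδ : 0 < δ) (h : δ ≤ |x - round x|) :
    ‖∑ j ∈ Finset.range L, ee (j * x)‖ ≤ 1 / δ := by
  have h1 : (∑ j ∈ Finset.range L, ee (j * x)) * (ee x - 1) = ee x ^ L - 1 := by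
    rw [← geom_sum_mul]
    simp_rw [ee_nat_mul]
  have h2 : ‖∑ j ∈ Finset.range L, ee (j * x)‖ * ‖ee x - 1‖ ≤ 2 := by
    rw [← norm_mul, h1]
    refine (norm_sub_le _ _).trans ?_
    rw [norm_pow, ee_norm]
    norm_num
  have h3 := ee_lower x
  rw [le_div_iff₀ hδ]
  nlinarith [norm_nonneg (∑ j ∈ Finset.range L, ee (j * x))]

lemma shift_sum (u : ℤ → ℂ) (hu : ∀ k, ‖u k‖ ≤ 1) (p q : ℤ) (hpq : p ≤ q) (j : ℕ) :
    ‖∑ k ∈ Finset.Ico p q, u k - ∑ k ∈ Finset.Ico p q, u (k + j)‖ ≤ 2 * j := by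
  induction j with
  | zero => simp
  | succ j ih =>
    have h : ∑ k ∈ Finset.Ico p q, u (k + j) - ∑ k ∈ Finset.Ico p q, u (k + (j + 1 : ℕ))
        = u (p + j) - u (q + j) := by
      clear ih
      induction q, hpq using Int.leInduction with
      | base => simp
      | succ q hq ih =>
        have h1 : Finset.Ico p (q + 1) = insert q (Finset.Ico p q) := by
          ext x; simp; omega
        rw [h1, Finset.sum_insert (by simp), Finset.sum_insert (by simp)]
        have h2 : q + (j + 1 : ℕ) = q + 1 + (j : ℤ) := by push_cast; ring
        rw [h2]
        linear_combination ih
    have h3 : ‖u (p + j) - u (q + j)‖ ≤ 2 :=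
      (norm_sub_le _ _).trans (by linarith [hu (p + j), hu (q + j)])
    rw [← h] at h3
    have h4 := norm_add_le (∑ k ∈ Finset.Ico p q, u k - ∑ k ∈ Finset.Ico p q, u (k + j))
      (∑ k ∈ Finset.Ico p q, u (k + j) - ∑ k ∈ Finset.Ico p q, u (k + (j + 1 : ℕ)))
    rw [sub_add_sub_cancel] at h4
    push_cast at h4 ⊢
    push_cast at h3
    linarith

lemma block_sum (u : ℤ → ℂ) (hu : ∀ k, ‖u k‖ ≤ 1) (p q : ℤ) (hpq : p ≤ q) (L : ℕ) :
    L * ‖∑ k ∈ Finset.Ico p q, u k‖ ≤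
      ∑ k ∈ Finset.Ico p q, ‖∑ j ∈ Finset.range L, u (k + j)‖ + 2 * L * L := by
  have h1 : (L : ℂ) * ∑ k ∈ Finset.Ico p q, u k =
      ∑ k ∈ Finset.Ico p q, ∑ j ∈ Finset.range L, u (k + j) +
      ∑ j ∈ Finset.range L, (∑ k ∈ Finset.Ico p q, u k - ∑ k ∈ Finset.Ico p q, u (k + j)) := by
    rw [Finset.sum_comm, ← Finset.sum_add_distrib]
    simp
  have h2 : (L : ℝ) * ‖∑ k ∈ Finset.Ico p q, u k‖ = ‖(L : ℂ) * ∑ k ∈ Finset.Ico p q, u k‖ := by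
    rw [norm_mul]; simp
  rw [h2, h1]
  refine (norm_add_le _ _).trans (add_le_add (norm_sum_le _ _) ?_)
  refine (norm_sum_le_of_le (Finset.range L) (f := fun j : ℕ => (∑ k ∈ Finset.Ico p q, u k - ∑ k ∈ Finset.Ico p q, u (k + j)))
    (n := fun _ => 2 * (L : ℝ)) ?_).trans ?_
  · intro j hj
    refine (shift_sum u hu p q hpq j).trans ?_
    have : (j : ℝ) ≤ L := by exact_mod_cast (Finset.mem_range.1 hj).le
    linarith
  · simp; linarith

lemma card_le_of_diam (S : Finset ℤ) (D : ℝ) (hD : 0 ≤ D)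
    (h : ∀ k ∈ S, ∀ l ∈ S, (l : ℝ) - k ≤ D) : (S.card : ℝ) ≤ D + 1 := by
  rcases S.eq_empty_or_nonempty with rfl | hS
  · simp; linarith
  · have h1 : S ⊆ Finset.Icc (S.min' hS) (S.max' hS) := fun x hx =>
      Finset.mem_Icc.2 ⟨S.min'_le x hx, S.le_max' x hx⟩
    have h2 := Finset.card_le_card h1
    rw [Int.card_Icc] at h2
    have h3 := h _ (S.min'_mem hS) _ (S.max'_mem hS)
    have h4 : S.min' hS ≤ S.max' hS := S.min'_le _ (S.max'_mem hS)
    have h5 : (S.card : ℤ) ≤ S.max' hS + 1 - S.min' hS := by omega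
    have h6 : (S.card : ℝ) ≤ S.max' hS + 1 - S.min' hS := by exact_mod_cast h5
    linarith

lemma taylor_bound (A B : ℝ) (ψ g : ℝ → ℝ)
    (hd : ∀ x ∈ Set.Icc A B, HasDerivWithinAt ψ (g x) (Set.Icc A B) x)
    (x y η : ℝ) (hx : x ∈ Set.Icc A B) (hy : y ∈ Set.Icc A B) (hxy : x ≤ y)
    (hη : ∀ z ∈ Set.Icc x y, |g z - g x| ≤ η) :
    |ψ y - ψ x - g x * (y - x)| ≤ η * (y - x) := by
  have hsub : Set.Icc x y ⊆ Set.Icc A B := Set.Icc_subset_Icc hx.1 hy.2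
  have h1 : ∀ z ∈ Set.Icc x y,
      HasDerivWithinAt (fun z => ψ z - g x * z) (g z - g x) (Set.Icc x y) z := by
    intro z hz
    have h2 := ((hd z (hsub hz)).mono hsub).fun_sub
      (((hasDerivAt_id z).const_mul (g x)).hasDerivWithinAt (s := Set.Icc x y))
    simpa using h2
  have h3 := (convex_Icc x y).norm_image_sub_le_of_norm_hasDerivWithin_le h1
    (C := η) (fun z hz => by simpa using hη z hz) (Set.left_mem_Icc.2 hxy) (Set.right_mem_Icc.2 hxy)
  rw [Real.norm_eq_abs, Real.norm_eq_abs, abs_of_nonneg (sub_nonneg.2 hxy)] at h3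
  have h4 : ψ y - ψ x - g x * (y - x) = ψ y - g x * y - (ψ x - g x * x) := by ring
  rw [h4]
  exact h3

lemma block_approx (A B : ℝ) (ψ g : ℝ → ℝ)
    (hd : ∀ x ∈ Set.Icc A B, HasDerivWithinAt ψ (g x) (Set.Icc A B) x)
    (n : ℕ) (hn : 0 < n) (L : ℕ) (η : ℝ) (hη0 : 0 ≤ η)
    (hη : ∀ x ∈ Set.Icc A B, ∀ z ∈ Set.Icc A B, |z - x| ≤ L / n → |g z - g x| ≤ η)
    (k : ℤ) (hk : ∀ j : ℕ, j < L → ((k + j : ℤ) : ℝ) / n ∈ Set.Icc A B) :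
    ‖∑ j ∈ Finset.range L, ee (n * ψ (((k + j : ℤ) : ℝ) / n))‖ ≤
      ‖∑ j ∈ Finset.range L, ee (j * g ((k : ℝ) / n))‖ + 2 * π * L * L * η := by
  have hn' : (0 : ℝ) < n := by exact_mod_cast hn
  set x : ℝ := (k : ℝ) / n with hx
  have h1 : ∀ j ∈ Finset.range L,
      ‖ee (n * ψ (((k + j : ℤ) : ℝ) / n)) - ee (n * ψ x) * ee (j * g x)‖ ≤ 2 * π * L * η := by
    intro j hj
    have hj' := Finset.mem_range.1 hj
    have hjL : (j : ℝ) ≤ L := by exact_mod_cast hj'.le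
    have hxm : x ∈ Set.Icc A B := by simpa using hk 0 (by omega)
    have hym := hk j hj'
    set y : ℝ := ((k + j : ℤ) : ℝ) / n with hy
    have hyx : y - x = j / n := by
      rw [hy, hx]; push_cast; field_simp; ring
    have hyx0 : (0 : ℝ) ≤ j / n := by positivity
    have ht := taylor_bound A B ψ g hd x y η hxm hym (by linarith) (by
      intro z hz
      refine hη x hxm z ⟨hxm.1.trans hz.1, hz.2.trans hym.2⟩ ?_
      rw [abs_of_nonneg (by linarith [hz.1])]
      have : (j : ℝ) / n ≤ L / n := by gcongr
      linarith [hz.2])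
    rw [← ee_add]
    refine (ee_lip _ _).trans ?_
    have h2 : (n : ℝ) * ψ y - (n * ψ x + j * g x) = n * (ψ y - ψ x - g x * (y - x)) := by
      rw [hyx]; field_simp; ring
    rw [h2, abs_mul, abs_of_pos hn']
    have h3 : (n : ℝ) * |ψ y - ψ x - g x * (y - x)| ≤ L * η := by
      calc (n : ℝ) * |ψ y - ψ x - g x * (y - x)| ≤ n * (η * (y - x)) := by gcongr
        _ = j * η := by rw [hyx]; field_simp
        _ ≤ L * η := by gcongr
    calc 2 * π * ((n : ℝ) * |ψ y - ψ x - g x * (y - x)|) ≤ 2 * π * (L * η) := by gcongr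
      _ = _ := by ring
  have h2 : ‖∑ j ∈ Finset.range L, ee (n * ψ (((k + j : ℤ) : ℝ) / n)) -
      ∑ j ∈ Finset.range L, ee (n * ψ x) * ee (j * g x)‖ ≤ 2 * π * L * L * η := by
    rw [← Finset.sum_sub_distrib]
    refine (norm_sum_le_of_le _ h1).trans ?_
    simp
    linarith
  rw [← Finset.mul_sum] at h2
  have h3 : ‖ee (n * ψ x) * ∑ j ∈ Finset.range L, ee (j * g x)‖ =
      ‖∑ j ∈ Finset.range L, ee (j * g x)‖ := by rw [norm_mul, ee_norm, one_mul]
  rw [← h3]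
  have h4 := norm_sub_norm_le (∑ j ∈ Finset.range L, ee (n * ψ (((k + j : ℤ) : ℝ) / n)))
    (ee (n * ψ x) * ∑ j ∈ Finset.range L, ee (j * g x))
  linarith

lemma core_finite (A B ρ : ℝ) (hρ : 0 < ρ) (ψ g : ℝ → ℝ)
    (hd : ∀ x ∈ Set.Icc A B, HasDerivWithinAt ψ (g x) (Set.Icc A B) x)
    (hg : ∀ x ∈ Set.Icc A B, ∀ y ∈ Set.Icc A B, ρ * |x - y| ≤ |g x - g y|)
    (M : ℕ) (hM : ∀ x ∈ Set.Icc A B, |g x| + 1 ≤ M) (δ : ℝ) (hδ : 0 < δ)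
    (n : ℕ) (hn : 0 < n) (L : ℕ) (η : ℝ) (hη0 : 0 ≤ η)
    (hη : ∀ x ∈ Set.Icc A B, ∀ z ∈ Set.Icc A B, |z - x| ≤ L / n → |g z - g x| ≤ η)
    (p q : ℤ) (hpq : p ≤ q) (hK : ∀ k ∈ Finset.Ico p q, ((k : ℤ) : ℝ) / n ∈ Set.Icc A B) :
    L * ‖∑ k ∈ Finset.Ico p q, ee (n * ψ ((k : ℝ) / n))‖ ≤
      ((Finset.Ico p q).card : ℝ) * (1 / δ + 2 * π * L * L * η) +
      L * (L + (2 * M + 1) * (2 * δ * n / ρ + 1)) + 2 * L * L := by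
  have hn' : (0 : ℝ) < n := by exact_mod_cast hn
  refine (block_sum (fun k : ℤ => ee (n * ψ ((k : ℝ) / n))) (fun k => (ee_norm _).le) p q hpq L).trans ?_
  set near : ℤ → Finset ℤ := fun m => (Finset.Ico p q).filter (fun k => |g ((k : ℝ) / n) - m| < δ)
    with hnear
  set bad : Finset ℤ := Finset.Ico (q - L) q ∪ (Finset.Icc (-(M : ℤ)) M).biUnion near with hbad
  have hnearc : ∀ m ∈ Finset.Icc (-(M : ℤ)) M, ((near m).card : ℝ) ≤ 2 * δ * n / ρ + 1 := by
    intro m _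
    refine card_le_of_diam _ _ (by positivity) ?_
    intro k hk l hl
    obtain ⟨hk1, hk2⟩ := Finset.mem_filter.1 hk
    obtain ⟨hl1, hl2⟩ := Finset.mem_filter.1 hl
    have h1 := hg _ (hK l hl1) _ (hK k hk1)
    have h2 : |g ((l : ℝ) / n) - g ((k : ℝ) / n)| ≤ 2 * δ := by
      rw [abs_lt] at hk2 hl2
      rw [abs_le]
      constructor <;> linarith [hk2.1, hk2.2, hl2.1, hl2.2]
    have h3 : ρ * (((l : ℝ) - k) / n) ≤ 2 * δ := by
      have : ((l : ℝ) - k) / n ≤ |(l : ℝ) / n - k / n| := by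
        rw [← sub_div]; exact le_abs_self _
      nlinarith
    rw [le_div_iff₀ hρ]
    have h4 : ρ * (((l : ℝ) - k) / n) * n = ((l : ℝ) - k) * ρ := by field_simp
    nlinarith
  have hbadc : (bad.card : ℝ) ≤ L + (2 * M + 1) * (2 * δ * n / ρ + 1) := by
    have h1 : bad.card ≤ L + ∑ m ∈ Finset.Icc (-(M : ℤ)) M, (near m).card := by
      refine (Finset.card_union_le _ _).trans (add_le_add ?_ Finset.card_biUnion_le)
      rw [Int.card_Ico]; omega
    have h2 : (bad.card : ℝ) ≤ L + ∑ m ∈ Finset.Icc (-(M : ℤ)) M, ((near m).card : ℝ) := by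
      exact_mod_cast h1
    have h3 := Finset.sum_le_sum hnearc
    rw [Finset.sum_const, Int.card_Icc, nsmul_eq_mul] at h3
    have h4 : (((M : ℤ) + 1 - -(M : ℤ)).toNat : ℝ) = 2 * M + 1 := by
      have : ((M : ℤ) + 1 - -(M : ℤ)).toNat = 2 * M + 1 := by omega
      rw [this]; push_cast; ring
    rw [h4] at h3
    linarith
  have hC : 0 ≤ 1 / δ + 2 * π * L * L * η := by positivity
  have hpt : ∀ k ∈ Finset.Ico p q, ‖∑ j ∈ Finset.range L, ee (n * ψ (((k + j : ℤ) : ℝ) / n))‖ ≤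
      (1 / δ + 2 * π * L * L * η) + (if k ∈ bad then (L : ℝ) else 0) := by
    intro k hk
    split_ifs with hb
    · have : ‖∑ j ∈ Finset.range L, ee (n * ψ (((k + j : ℤ) : ℝ) / n))‖ ≤ L := by
        refine (norm_sum_le_of_le _ (fun j _ => (ee_norm _).le)).trans ?_
        simp
      linarith
    · rw [hbad, Finset.mem_union, not_or] at hb
      obtain ⟨hb1, hb2⟩ := hb
      have hk' := Finset.mem_Ico.1 hk
      have hkq : k < q - L := by
        by_contra hcon
        exact hb1 (Finset.mem_Ico.2 ⟨by omega, hk'.2⟩)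
      have h1 := block_approx A B ψ g hd n hn L η hη0 hη k (fun j hj => hK _ (Finset.mem_Ico.2 (by omega)))
      have h2 : δ ≤ |g ((k : ℝ) / n) - round (g ((k : ℝ) / n))| := by
        by_contra hcon
        rw [not_le] at hcon
        apply hb2
        rw [Finset.mem_biUnion]
        refine ⟨round (g ((k : ℝ) / n)), ?_, Finset.mem_filter.2 ⟨hk, hcon⟩⟩
        have h3 := hM _ (hK k hk)
        have h4 := abs_sub_round (g ((k : ℝ) / n))
        have h5 : |((round (g ((k : ℝ) / n)) : ℤ) : ℝ)| ≤ M := by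
          have h6 := neg_abs_le (g ((k : ℝ) / n))
          have h7 := le_abs_self (g ((k : ℝ) / n))
          rw [abs_le] at h4 ⊢
          constructor <;> linarith [h4.1, h4.2]
        rw [Finset.mem_Icc, ← abs_le]
        exact_mod_cast h5
      have h3 := ee_geom L _ δ hδ h2
      linarith
  have hsum := Finset.sum_le_sum hpt
  rw [Finset.sum_add_distrib, Finset.sum_const, nsmul_eq_mul, ← Finset.sum_filter, Finset.sum_const,
    nsmul_eq_mul] at hsum
  have h5 : (((Finset.Ico p q).filter (fun k => k ∈ bad)).card : ℝ) ≤ bad.card := by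
    exact_mod_cast Finset.card_le_card (fun x hx => (Finset.mem_filter.1 hx).2)
  have h6 : (((Finset.Ico p q).filter (fun k => k ∈ bad)).card : ℝ) * L ≤
      L * (L + (2 * M + 1) * (2 * δ * n / ρ + 1)) := by
    rw [mul_comm]
    have := h5.trans hbadc
    gcongr
  linarith

lemma core (A B ρ : ℝ) (hAB : A ≤ B) (hρ : 0 < ρ) (ψ g : ℝ → ℝ)
    (hd : ∀ x ∈ Set.Icc A B, HasDerivWithinAt ψ (g x) (Set.Icc A B) x)
    (hgc : ContinuousOn g (Set.Icc A B))
    (hg : ∀ x ∈ Set.Icc A B, ∀ y ∈ Set.Icc A B, ρ * |x - y| ≤ |g x - g y|)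
    (ε : ℝ) (hε : 0 < ε) :
    ∀ᶠ n : ℕ in atTop, ∀ p q : ℤ, p ≤ q →
      (∀ k ∈ Finset.Ico p q, ((k : ℤ) : ℝ) / n ∈ Set.Icc A B) →
      ‖∑ k ∈ Finset.Ico p q, ee (n * ψ ((k : ℝ) / n))‖ ≤ ε * n := by
  obtain ⟨G, hG⟩ := isCompact_Icc.exists_bound_of_continuousOn hgc
  obtain ⟨M, hM⟩ := exists_nat_ge (G + 1)
  have hM' : ∀ x ∈ Set.Icc A B, |g x| + 1 ≤ M := fun x hx => by
    have := hG x hx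
    rw [Real.norm_eq_abs] at this
    linarith
  set δ : ℝ := ε * ρ / (8 * (2 * M + 1)) with hδdef
  have hδ : 0 < δ := by positivity
  have hδ2 : (2 * M + 1) * (2 * δ / ρ) = ε / 4 := by
    rw [hδdef]; field_simp; ring
  have hD : 0 < B - A + 1 := by linarith
  obtain ⟨L, hL⟩ := exists_nat_ge ((B - A + 1) / δ * (4 / ε) + 1)
  have hLpos : (0 : ℝ) < L := by
    have : 0 < (B - A + 1) / δ * (4 / ε) := by positivity
    linarith
  have hL2 : (B - A + 1) * (1 / δ) ≤ L * (ε / 4) := by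
    have h1 : (B - A + 1) / δ * (4 / ε) ≤ L := by linarith
    calc (B - A + 1) * (1 / δ) = (B - A + 1) / δ * (4 / ε) * (ε / 4) := by field_simp
      _ ≤ _ := by gcongr
  set η : ℝ := ε / 4 / ((B - A + 1) * (2 * π * L)) with hηdef
  have hη0 : 0 < η := by positivity
  have hη2 : (B - A + 1) * (2 * π * L * L * η) = L * (ε / 4) := by
    rw [hηdef]; field_simp
  have huc := isCompact_Icc.uniformContinuousOn_of_continuous hgc
  rw [Metric.uniformContinuousOn_iff] at huc
  obtain ⟨d, hd0, hdd⟩ := huc η hη0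
  obtain ⟨N1, hN1⟩ := exists_nat_gt (L / d)
  obtain ⟨N2, hN2⟩ := exists_nat_ge ((3 * L + (2 * M + 1)) / (ε / 4))
  filter_upwards [eventually_ge_atTop (N1 + N2 + 1)] with n hn p q hpq hK
  have hn0 : 0 < n := by omega
  have hn' : (0 : ℝ) < n := by exact_mod_cast hn0
  have hnN1 : (N1 : ℝ) ≤ n := by exact_mod_cast (by omega : N1 ≤ n)
  have hnN2 : (N2 : ℝ) ≤ n := by exact_mod_cast (by omega : N2 ≤ n)
  have hLn : (L : ℝ) / n < d := by
    rw [div_lt_iff₀ hn']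
    have h1 := hN1.trans_le hnN1
    rw [div_lt_iff₀ hd0] at h1
    linarith
  have hbig : 3 * (L : ℝ) + (2 * M + 1) ≤ n * (ε / 4) := by
    rw [← div_le_iff₀ (by positivity)]
    exact hN2.trans hnN2
  have hmain := core_finite A B ρ hρ ψ g hd hg M hM' δ hδ n hn0 L η hη0.le (by
    intro x hx z hz hxz
    have := hdd z hz x hx (by rw [Real.dist_eq]; linarith)
    rw [Real.dist_eq] at this
    exact this.le) p q hpq hK
  have hcard : ((Finset.Ico p q).card : ℝ) ≤ n * (B - A + 1) := by
    have h1 := card_le_of_diam (Finset.Ico p q) (n * (B - A))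
      (mul_nonneg hn'.le (by linarith)) (by
        intro k hk l hl
        have h1 := (hK k hk).1
        have h2 := (hK l hl).2
        rw [le_div_iff₀ hn'] at h1
        rw [div_le_iff₀ hn'] at h2
        nlinarith)
    have h2 : (1 : ℝ) ≤ n := by exact_mod_cast hn0
    nlinarith
  have hC : 0 ≤ 1 / δ + 2 * π * L * L * η := by positivity
  have h1 : ((Finset.Ico p q).card : ℝ) * (1 / δ + 2 * π * L * L * η) ≤ n * (L * (ε / 2)) := by
    calc ((Finset.Ico p q).card : ℝ) * (1 / δ + 2 * π * L * L * η)
        ≤ (n * (B - A + 1)) * (1 / δ + 2 * π * L * L * η) := by gcongr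
      _ = n * ((B - A + 1) * (1 / δ) + (B - A + 1) * (2 * π * L * L * η)) := by ring
      _ ≤ n * (L * (ε / 4) + L * (ε / 4)) := by rw [hη2]; gcongr
      _ = _ := by ring
  have h2 : (2 * (M : ℝ) + 1) * (2 * δ * n / ρ + 1) = ε / 4 * n + (2 * M + 1) := by
    rw [← hδ2]; ring
  rw [h2] at hmain
  have h3 : L * ‖∑ k ∈ Finset.Ico p q, ee (n * ψ ((k : ℝ) / n))‖ ≤ L * (ε * n) := by
    have h4 : (L : ℝ) * (3 * (L : ℝ) + (2 * M + 1)) ≤ L * (n * (ε / 4)) := by gcongr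
    nlinarith
  exact le_of_mul_le_mul_left h3 hLpos

lemma haar_fourier (h : ℤ) (hh : h ≠ 0) :
    ∫ t : AddCircle (1 : ℝ), fourier h t ∂AddCircle.haarAddCircle = 0 := by
  exact integral_eq_zero_of_add_right_eq_neg (μ := AddCircle.haarAddCircle)
    (fourier_add_half_inv_index hh (by norm_num))

lemma cont_integrable (f : C(AddCircle (1 : ℝ), ℂ)) :
    Integrable (fun t => f t) (AddCircle.haarAddCircle (T := (1 : ℝ))) :=
  f.continuous.integrable_of_hasCompactSupport (HasCompactSupport.of_compactSpace _)

lemma weyl_span (K : ℕ → Finset ℤ) (x : ℕ → ℤ → ℝ) (c : ℝ)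
    (hc : Tendsto (fun n : ℕ => ((K n).card : ℝ) / n) atTop (𝓝 c))
    (he : ∀ h : ℤ, h ≠ 0 →
      Tendsto (fun n : ℕ => (∑ k ∈ K n, ee (h * x n k)) / (n : ℂ)) atTop (𝓝 0))
    (f : C(AddCircle (1 : ℝ), ℂ)) (hf : f ∈ Submodule.span ℂ (Set.range (@fourier 1))) :
    Tendsto (fun n : ℕ => (∑ k ∈ K n, f ((x n k : ℝ) : AddCircle (1 : ℝ))) / (n : ℂ)) atTop
      (𝓝 (c * ∫ t, f t ∂AddCircle.haarAddCircle)) := by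
  induction hf using Submodule.span_induction with
  | mem f hf =>
    obtain ⟨h, rfl⟩ := hf
    by_cases hh : h = 0
    · subst hh
      have h1 := (Complex.continuous_ofReal.tendsto c).comp hc
      simp only [fourier_zero, integral_const, Finset.sum_const]
      simpa [Function.comp_def] using h1
    · rw [haar_fourier h hh, mul_zero]
      refine (he h hh).congr ?_
      intro n
      congr 1
      refine Finset.sum_congr rfl fun k _ => ?_
      rw [fourier_coe_apply]
      unfold ee
      congr 1
      push_cast
      ring
  | zero => simp
  | add f g _ _ ihf ihg =>
    have h1 := ihf.add ihg
    have h2 : ∫ t, (f + g) t ∂AddCircle.haarAddCircle =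
        ∫ t, f t ∂AddCircle.haarAddCircle + ∫ t, g t ∂AddCircle.haarAddCircle :=
      integral_add (cont_integrable f) (cont_integrable g)
    rw [h2, mul_add]
    refine h1.congr fun n => ?_
    rw [← add_div, ← Finset.sum_add_distrib]
    rfl
  | smul a f _ ih =>
    have h1 := ih.const_mul a
    have h2 : ∫ t, (a • f) t ∂AddCircle.haarAddCircle = a * ∫ t, f t ∂AddCircle.haarAddCircle :=
      integral_const_mul a _
    rw [h2, mul_left_comm]
    refine h1.congr fun n => ?_
    rw [← mul_div_assoc, Finset.mul_sum]
    rfl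

lemma weyl_cont (K : ℕ → Finset ℤ) (x : ℕ → ℤ → ℝ) (c : ℝ)
    (hc : Tendsto (fun n : ℕ => ((K n).card : ℝ) / n) atTop (𝓝 c))
    (he : ∀ h : ℤ, h ≠ 0 →
      Tendsto (fun n : ℕ => (∑ k ∈ K n, ee (h * x n k)) / (n : ℂ)) atTop (𝓝 0))
    (f : C(AddCircle (1 : ℝ), ℂ)) :
    Tendsto (fun n : ℕ => (∑ k ∈ K n, f ((x n k : ℝ) : AddCircle (1 : ℝ))) / (n : ℂ)) atTop
      (𝓝 (c * ∫ t, f t ∂AddCircle.haarAddCircle)) := by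
  have hc0 : 0 ≤ c := ge_of_tendsto' hc fun n => by positivity
  have hf : f ∈ closure ((Submodule.span ℂ (Set.range (@fourier 1)) :
      Submodule ℂ C(AddCircle (1 : ℝ), ℂ)) : Set C(AddCircle (1 : ℝ), ℂ)) := by
    have h1 : f ∈ (Submodule.span ℂ (Set.range (@fourier 1))).topologicalClosure := by
      rw [span_fourier_closure_eq_top]; trivial
    exact h1
  rw [Metric.tendsto_nhds]
  intro ε hε
  rw [Metric.mem_closure_iff] at hf
  obtain ⟨P, hP, hfP⟩ := hf (ε / (3 * (c + 1))) (by positivity)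
  set s := ε / (3 * (c + 1)) with hs
  have hs3 : s * (c + 1) = ε / 3 := by rw [hs]; field_simp
  have hpt : ∀ t, ‖f t - P t‖ ≤ s := fun t => by
    rw [← dist_eq_norm]
    exact (ContinuousMap.dist_apply_le_dist t).trans hfP.le
  have h1 := (Metric.tendsto_nhds.1 (weyl_span K x c hc he P hP)) (ε / 3) (by positivity)
  have h2 : ∀ᶠ n : ℕ in atTop, ((K n).card : ℝ) / n < c + 1 := hc.eventually_lt_const (by linarith)
  filter_upwards [h1, h2] with n hn1 hn2
  rw [dist_eq_norm] at hn1 ⊢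
  have h3 : ‖(∑ k ∈ K n, f ((x n k : ℝ) : AddCircle (1 : ℝ))) / (n : ℂ) -
      (∑ k ∈ K n, P ((x n k : ℝ) : AddCircle (1 : ℝ))) / (n : ℂ)‖ ≤ s * (c + 1) := by
    rw [← sub_div, ← Finset.sum_sub_distrib, norm_div, Complex.norm_natCast]
    have h4 : ‖∑ k ∈ K n, (f ((x n k : ℝ) : AddCircle (1 : ℝ)) - P ((x n k : ℝ) : AddCircle (1 : ℝ)))‖
        ≤ (K n).card * s := by
      refine (norm_sum_le_of_le _ (fun k _ => hpt _)).trans ?_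
      simp
    calc _ ≤ (K n).card * s / n := by gcongr
      _ = s * ((K n).card / n) := by ring
      _ ≤ s * (c + 1) := by
        have : 0 < s := by positivity
        gcongr
  have h5 : ‖(c : ℂ) * ∫ t, P t ∂AddCircle.haarAddCircle -
      (c : ℂ) * ∫ t, f t ∂AddCircle.haarAddCircle‖ ≤ s * c := by
    rw [← mul_sub, ← integral_sub (cont_integrable P) (cont_integrable f), norm_mul,
      Complex.norm_real, Real.norm_eq_abs, abs_of_nonneg hc0, mul_comm]
    gcongr
    have := norm_integral_le_of_norm_le_const (μ := AddCircle.haarAddCircle (T := (1 : ℝ)))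
      (f := fun t => P t - f t) (C := s)
      (Eventually.of_forall fun t => by rw [norm_sub_rev]; exact hpt t)
    simpa using this
  have h6 : s * c < ε / 3 := by
    have : 0 < s := by positivity
    nlinarith
  have h7 := norm_add₃_le
    (a := (∑ k ∈ K n, f ((x n k : ℝ) : AddCircle (1 : ℝ))) / (n : ℂ) -
      (∑ k ∈ K n, P ((x n k : ℝ) : AddCircle (1 : ℝ))) / (n : ℂ))
    (b := (∑ k ∈ K n, P ((x n k : ℝ) : AddCircle (1 : ℝ))) / (n : ℂ) -
      c * ∫ t, P t ∂AddCircle.haarAddCircle)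
    (c := (c : ℂ) * ∫ t, P t ∂AddCircle.haarAddCircle - c * ∫ t, f t ∂AddCircle.haarAddCircle)
  rw [sub_add_sub_cancel, sub_add_sub_cancel] at h7
  linarith

lemma weyl_lower (K : ℕ → Finset ℤ) (x : ℕ → ℤ → ℝ) (c : ℝ)
    (hc : Tendsto (fun n : ℕ => ((K n).card : ℝ) / n) atTop (𝓝 c))
    (he : ∀ h : ℤ, h ≠ 0 →
      Tendsto (fun n : ℕ => (∑ k ∈ K n, ee (h * x n k)) / (n : ℂ)) atTop (𝓝 0))
    (a b : ℝ) (ha : 0 ≤ a) (hb : b ≤ 1) (hab : a ≤ b) (ε : ℝ) (hε : 0 < ε) :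
    ∀ᶠ n : ℕ in atTop, c * (b - a) - ε ≤
      (((K n).filter (fun k => Int.fract (x n k) ∈ Set.Ioo a b)).card : ℝ) / n := by
  have hc0 : 0 ≤ c := ge_of_tendsto' hc fun n => by positivity
  set s : ℝ := ε / (4 * (c + 1)) with hs
  have hs0 : 0 < s := by positivity
  have hs3 : s * (c + 1) = ε / 4 := by rw [hs]; field_simp
  set w : ℝ → ℝ := fun t => max 0 (min 1 (min (t - a) (b - t) / s)) with hw
  have hwc : Continuous w := by
    rw [hw]; fun_prop
  have hw0 : ∀ t, 0 ≤ w t := fun t => le_max_left _ _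
  have hw1 : ∀ t, w t ≤ 1 := fun t => max_le zero_le_one (min_le_left _ _)
  have hwout : ∀ t, t ∉ Set.Ioo a b → w t = 0 := by
    intro t ht
    apply max_eq_left
    refine (min_le_right _ _).trans ?_
    apply div_nonpos_of_nonpos_of_nonneg _ hs0.le
    by_cases h1 : a < t
    · have h2 : b ≤ t := by
        by_contra h3
        exact ht ⟨h1, not_le.1 h3⟩
      exact (min_le_right _ _).trans (by linarith)
    · exact (min_le_left _ _).trans (by linarith)
  have hwin : ∀ t ∈ Set.Ioc (a + s) (b - s), w t = 1 := by
    intro t ht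
    have h1 : 1 ≤ min (t - a) (b - t) / s := by
      rw [le_div_iff₀ hs0, one_mul]
      exact le_min (by linarith [ht.1]) (by linarith [ht.2])
    rw [hw]
    simp only
    rw [min_eq_left h1]
    norm_num
  have hend : w 0 = w (0 + 1) := by
    rw [hwout 0 (fun h => by linarith [h.1]), hwout (0 + 1) (fun h => by linarith [h.2])]
  let f : C(AddCircle (1 : ℝ), ℂ) := ⟨AddCircle.liftIco 1 0 (fun t => (w t : ℂ)),
    AddCircle.liftIco_continuous (by rw [hend]) (by fun_prop)⟩
  have hfx : ∀ y : ℝ, f (y : AddCircle (1 : ℝ)) = (w (Int.fract y) : ℂ) := by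
    intro y
    rw [← AddCircle.coe_fract y]
    exact AddCircle.liftIco_coe_apply (f := fun t => (w t : ℂ)) ⟨Int.fract_nonneg y, by
      rw [zero_add]; exact Int.fract_lt_one y⟩
  have hint : ∫ t, f t ∂AddCircle.haarAddCircle = ((∫ t in (0 : ℝ)..1, w t : ℝ) : ℂ) := by
    rw [AddCircle.integral_haarAddCircle]
    have h1 : ∫ t, f t = ∫ t in (0 : ℝ)..0 + 1, (w t : ℂ) := by
      rw [← AddCircle.intervalIntegral_preimage 1 0]
      apply intervalIntegral.integral_congr
      intro t ht
      rw [Set.uIcc_of_le (by norm_num)] at ht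
      simp only [hfx]
      rcases eq_or_lt_of_le ht.2 with h | h
      · rw [h, ← hend]
        simp
      · rw [Int.fract_eq_self.2 ⟨ht.1, by simpa using h⟩]
    rw [h1, zero_add, intervalIntegral.integral_ofReal]
    simp
  have hlow : b - a - 2 * s ≤ ∫ t in (0 : ℝ)..1, w t := by
    rw [intervalIntegral.integral_of_le zero_le_one]
    have h1 : ∫ t in Set.Ioc (a + s) (b - s), w t ≤ ∫ t in Set.Ioc (0 : ℝ) 1, w t := by
      refine setIntegral_mono_set ?_ (Eventually.of_forall fun t => hw0 t) ?_
      · exact (hwc.integrableOn_Icc).mono_set Set.Ioc_subset_Icc_self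
      · exact (Set.Ioc_subset_Ioc (by linarith) (by linarith)).eventuallyLE
    have h2 : ∫ t in Set.Ioc (a + s) (b - s), w t = ∫ t in Set.Ioc (a + s) (b - s), (1 : ℝ) :=
      setIntegral_congr_fun measurableSet_Ioc hwin
    rw [h2] at h1
    simp at h1
    have h3 := le_max_left (b - s - (a + s)) 0
    linarith [h1]
  have hT := weyl_cont K x c hc he f
  have hT2 := (Complex.continuous_re.tendsto _).comp hT
  rw [hint, ← Complex.ofReal_mul, Complex.ofReal_re] at hT2
  have hev := hT2.eventually_const_lt (u := c * (b - a) - ε) (by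
    nlinarith)
  filter_upwards [hev] with n hn
  refine hn.le.trans ?_
  simp only [Function.comp_apply, hfx]
  rw [← Complex.ofReal_sum, ← Complex.ofReal_natCast, ← Complex.ofReal_div, Complex.ofReal_re]
  gcongr
  rw [Finset.card_eq_sum_ones, Finset.sum_filter]
  push_cast
  refine Finset.sum_le_sum fun k _ => ?_
  split_ifs with h
  · exact hw1 _
  · exact (hwout _ h).le

lemma weyl_interval (K : ℕ → Finset ℤ) (x : ℕ → ℤ → ℝ) (c : ℝ)
    (hc : Tendsto (fun n : ℕ => ((K n).card : ℝ) / n) atTop (𝓝 c))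
    (he : ∀ h : ℤ, h ≠ 0 →
      Tendsto (fun n : ℕ => (∑ k ∈ K n, ee (h * x n k)) / (n : ℂ)) atTop (𝓝 0))
    (a b : ℝ) (ha : 0 ≤ a) (hb : b ≤ 1) (hab : a ≤ b) (I : Set ℝ)
    (hI1 : Set.Ioo a b ⊆ I) (hI2 : I ⊆ Set.Icc a b) :
    Tendsto (fun n : ℕ => (((K n).filter (fun k => Int.fract (x n k) ∈ I)).card : ℝ) / n)
      atTop (𝓝 ((b - a) * c)) := by
  rw [Metric.tendsto_nhds]
  intro ε hε
  have e1 := weyl_lower K x c hc he a b ha hb hab (ε / 4) (by positivity)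
  have e2 := weyl_lower K x c hc he 0 a le_rfl (hab.trans hb) ha (ε / 4) (by positivity)
  have e3 := weyl_lower K x c hc he b 1 (ha.trans hab) le_rfl hb (ε / 4) (by positivity)
  have e4 := hc.eventually_lt_const (u := c + ε / 4) (by linarith)
  filter_upwards [e1, e2, e3, e4] with n h1 h2 h3 h4
  have s1 : ((K n).filter (fun k => Int.fract (x n k) ∈ Set.Ioo a b)).card ≤
      ((K n).filter (fun k => Int.fract (x n k) ∈ I)).card := by
    apply Finset.card_le_card
    intro k hk
    rw [Finset.mem_filter] at hk ⊢
    exact ⟨hk.1, hI1 hk.2⟩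
  have s2 : ((K n).filter (fun k => Int.fract (x n k) ∈ I)).card +
      ((K n).filter (fun k => Int.fract (x n k) ∈ Set.Ioo 0 a)).card +
      ((K n).filter (fun k => Int.fract (x n k) ∈ Set.Ioo b 1)).card ≤ (K n).card := by
    rw [← Finset.card_union_of_disjoint, ← Finset.card_union_of_disjoint]
    · apply Finset.card_le_card
      intro k hk
      simp only [Finset.mem_union, Finset.mem_filter] at hk
      tauto
    · rw [Finset.disjoint_left]
      intro k hk hk'
      simp only [Finset.mem_union, Finset.mem_filter] at hk hk'
      rcases hk with hk | hk
      · linarith [(hI2 hk.2).2, hk'.2.1]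
      · linarith [hk.2.2, hk'.2.1]
    · rw [Finset.disjoint_left]
      intro k hk hk'
      simp only [Finset.mem_filter] at hk hk'
      linarith [(hI2 hk.2).1, hk'.2.2]
  have s1' : (((K n).filter (fun k => Int.fract (x n k) ∈ Set.Ioo a b)).card : ℝ) / n ≤
      (((K n).filter (fun k => Int.fract (x n k) ∈ I)).card : ℝ) / n := by
    gcongr
  have s2' : (((K n).filter (fun k => Int.fract (x n k) ∈ I)).card : ℝ) / n +
      (((K n).filter (fun k => Int.fract (x n k) ∈ Set.Ioo 0 a)).card : ℝ) / n +
      (((K n).filter (fun k => Int.fract (x n k) ∈ Set.Ioo b 1)).card : ℝ) / n ≤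
      ((K n).card : ℝ) / n := by
    rw [← add_div, ← add_div]
    gcongr
    exact_mod_cast s2
  rw [Real.dist_eq, abs_lt]
  constructor <;> nlinarith

lemma interval_ends (A B : ℝ) (hAB : A ≤ B) (J : Set ℝ) (hJ : J.OrdConnected)
    (hsub : J ⊆ Set.Icc A B) : ∃ a b : ℝ, A ≤ a ∧ a ≤ b ∧ b ≤ B ∧ Set.Ioo a b ⊆ J ∧
      J ⊆ Set.Icc a b ∧ (volume J).toReal = b - a := by
  have key : ∃ a b : ℝ, A ≤ a ∧ a ≤ b ∧ b ≤ B ∧ Set.Ioo a b ⊆ J ∧ J ⊆ Set.Icc a b := by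
    rcases J.eq_empty_or_nonempty with rfl | hne
    · exact ⟨A, A, le_rfl, le_rfl, hAB, by simp, by simp⟩
    · have hbb : BddBelow J := ⟨A, fun x hx => (hsub hx).1⟩
      have hba : BddAbove J := ⟨B, fun x hx => (hsub hx).2⟩
      refine ⟨sInf J, sSup J, le_csInf hne fun x hx => (hsub hx).1, csInf_le_csSup hne hbb hba,
        csSup_le hne fun x hx => (hsub hx).2, ?_, fun x hx => ⟨csInf_le hbb hx, le_csSup hba hx⟩⟩
      intro x hx
      obtain ⟨y, hy, hyx⟩ := exists_lt_of_csInf_lt hne hx.1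
      obtain ⟨z, hz, hxz⟩ := exists_lt_of_lt_csSup hne hx.2
      exact hJ.out hy hz ⟨hyx.le, hxz.le⟩
  obtain ⟨a, b, h1, h2, h3, h4, h5⟩ := key
  refine ⟨a, b, h1, h2, h3, h4, h5, ?_⟩
  have v1 := measure_mono (μ := volume) h4
  have v2 := measure_mono (μ := volume) h5
  rw [Real.volume_Ioo] at v1
  rw [Real.volume_Icc] at v2
  rw [le_antisymm v2 v1, ENNReal.toReal_ofReal (by linarith)]

lemma count_limit (A B a b : ℝ) (J : Set ℝ) (h1 : A ≤ a) (h2 : a ≤ b) (h3 : b ≤ B)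
    (h4 : Set.Ioo a b ⊆ J) (h5 : J ⊆ Set.Icc a b) :
    Tendsto (fun n : ℕ => (((Finset.Icc ⌈A * n⌉ ⌊B * n⌋).filter
      (fun k : ℤ => (k : ℝ) / n ∈ J)).card : ℝ) / n) atTop (𝓝 (b - a)) := by
  have hinv : Tendsto (fun n : ℕ => 1 / (n : ℝ)) atTop (𝓝 0) := tendsto_one_div_atTop_nhds_zero_nat
  have hlo : Tendsto (fun n : ℕ => (b - a) - 1 / (n : ℝ)) atTop (𝓝 (b - a)) := by
    simpa using hinv.const_sub (b - a)
  have hhi : Tendsto (fun n : ℕ => (b - a) + 1 / (n : ℝ)) atTop (𝓝 (b - a)) := by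
    simpa using hinv.const_add (b - a)
  refine tendsto_of_tendsto_of_tendsto_of_le_of_le' hlo hhi ?_ ?_
  · filter_upwards [eventually_gt_atTop 0] with n hn
    have hn' : (0 : ℝ) < n := by exact_mod_cast hn
    have hs : Finset.Ioo ⌊a * n⌋ ⌈b * n⌉ ⊆ (Finset.Icc ⌈A * n⌉ ⌊B * n⌋).filter
        (fun k : ℤ => (k : ℝ) / n ∈ J) := by
      intro k hk
      rw [Finset.mem_Ioo, Int.floor_lt, Int.lt_ceil] at hk
      rw [Finset.mem_filter, Finset.mem_Icc, Int.ceil_le, Int.le_floor]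
      refine ⟨⟨by nlinarith, by nlinarith⟩, h4 ⟨?_, ?_⟩⟩
      · rw [lt_div_iff₀ hn']; exact hk.1
      · rw [div_lt_iff₀ hn']; exact hk.2
    have hcard := Finset.card_le_card hs
    rw [Int.card_Ioo] at hcard
    have hcard2 : ⌈b * n⌉ - ⌊a * n⌋ - 1 ≤ ((((Finset.Icc ⌈A * n⌉ ⌊B * n⌋).filter
        (fun k : ℤ => (k : ℝ) / n ∈ J)).card : ℕ) : ℤ) := by omega
    have hcard3 : (⌈b * n⌉ : ℝ) - ⌊a * n⌋ - 1 ≤ (((Finset.Icc ⌈A * n⌉ ⌊B * n⌋).filter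
        (fun k : ℤ => (k : ℝ) / n ∈ J)).card : ℝ) := by exact_mod_cast hcard2
    have f1 := Int.le_ceil (b * n)
    have f2 := Int.floor_le (a * n)
    rw [le_div_iff₀ hn', sub_mul, one_div, inv_mul_cancel₀ hn'.ne']
    linarith
  · filter_upwards [eventually_gt_atTop 0] with n hn
    have hn' : (0 : ℝ) < n := by exact_mod_cast hn
    have := card_le_of_diam ((Finset.Icc ⌈A * n⌉ ⌊B * n⌋).filter
      (fun k : ℤ => (k : ℝ) / n ∈ J)) ((b - a) * n) (mul_nonneg (by linarith) hn'.le) (by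
        intro k hk l hl
        have g1 := (h5 (Finset.mem_filter.1 hk).2).1
        have g2 := (h5 (Finset.mem_filter.1 hl).2).2
        rw [le_div_iff₀ hn'] at g1
        rw [div_le_iff₀ hn'] at g2
        linarith)
    rw [div_le_iff₀ hn', add_mul, one_div, inv_mul_cancel₀ hn'.ne']
    exact this

lemma filter_eq_Ico (A B : ℝ) (J : Set ℝ) (hJ : J.OrdConnected) (n : ℕ) (hn : 0 < n) :
    ∃ p q : ℤ, p ≤ q ∧ (Finset.Icc ⌈A * n⌉ ⌊B * n⌋).filter (fun k : ℤ => (k : ℝ) / n ∈ J) =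
      Finset.Ico p q := by
  have hn' : (0 : ℝ) < n := by exact_mod_cast hn
  set S := (Finset.Icc ⌈A * n⌉ ⌊B * n⌋).filter (fun k : ℤ => (k : ℝ) / n ∈ J) with hS
  rcases S.eq_empty_or_nonempty with h | h
  · exact ⟨0, 0, le_rfl, by rw [h]; simp⟩
  · have h0 : S.min' h ≤ S.max' h := S.min'_le _ (S.max'_mem h)
    refine ⟨S.min' h, S.max' h + 1, by omega, ?_⟩
    ext k
    rw [Finset.mem_Ico]
    constructor
    · intro hk
      have := S.min'_le k hk
      have := S.le_max' k hk
      omega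
    · rintro ⟨hk1, hk2⟩
      have hk2 : k ≤ S.max' h := by omega
      obtain ⟨m1, m2⟩ := Finset.mem_filter.1 (S.min'_mem h)
      obtain ⟨M1, M2⟩ := Finset.mem_filter.1 (S.max'_mem h)
      rw [hS, Finset.mem_filter]
      rw [Finset.mem_Icc] at m1 M1 ⊢
      refine ⟨⟨m1.1.trans hk1, hk2.trans M1.2⟩, hJ.out m2 M2 ⟨?_, ?_⟩⟩
      · have : ((S.min' h : ℤ) : ℝ) ≤ k := by exact_mod_cast hk1
        gcongr
      · have : (k : ℝ) ≤ ((S.max' h : ℤ) : ℝ) := by exact_mod_cast hk2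
        gcongr

lemma deriv_expand (A B ρ : ℝ) (φ' φ'' : ℝ → ℝ)
    (hd2 : ∀ x ∈ Set.Icc A B, HasDerivWithinAt φ' (φ'' x) (Set.Icc A B) x)
    (hconv : ∀ x ∈ Set.Icc A B, ρ ≤ φ'' x) :
    ∀ x ∈ Set.Icc A B, ∀ y ∈ Set.Icc A B, ρ * |x - y| ≤ |φ' x - φ' y| := by
  have main : ∀ x ∈ Set.Icc A B, ∀ y ∈ Set.Icc A B, x ≤ y → ρ * (y - x) ≤ φ' y - φ' x := by
    have hder : ∀ z ∈ interior (Set.Icc A B), HasDerivAt φ' (φ'' z) z := fun z hz =>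
      (hd2 z (interior_subset hz)).hasDerivAt (mem_interior_iff_mem_nhds.1 hz)
    exact (convex_Icc A B).mul_sub_le_image_sub_of_le_deriv
      (fun z hz => (hd2 z hz).continuousWithinAt)
      (fun z hz => (hder z hz).differentiableAt.differentiableWithinAt)
      (fun z hz => by rw [(hder z hz).deriv]; exact hconv z (interior_subset hz))
  intro x hx y hy
  rcases le_total x y with h | h
  · rw [abs_sub_comm x y, abs_sub_comm (φ' x), abs_of_nonneg (sub_nonneg.2 h)]
    exact (main x hx y hy h).trans (le_abs_self _)
  · rw [abs_of_nonneg (sub_nonneg.2 h)]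
    exact (main y hy x hx h).trans (le_abs_self _)

/-- Lemma 4: if `φ` is twice differentiable on `J₀ = [A,B]` with `φ'' ≥ ρ > 0`, then the
fractional parts `⟨n φ(k/n)⟩` are equidistributed on `[0,1]`: for every pair of
intervals `I ⊆ [0,1]`, `J ⊆ J₀`, the proportion of integers `k` with `k/n ∈ J` and
`⟨n φ(k/n)⟩ ∈ I` tends to `|I|·|J|`. -/
theorem fract_of_convex_equidistributed
    (A B ρ : ℝ) (hAB : A ≤ B) (hρ : 0 < ρ) (φ φ' φ'' : ℝ → ℝ)
    (hd1 : ∀ x ∈ Set.Icc A B, HasDerivWithinAt φ (φ' x) (Set.Icc A B) x)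
    (hd2 : ∀ x ∈ Set.Icc A B, HasDerivWithinAt φ' (φ'' x) (Set.Icc A B) x)
    (hconv : ∀ x ∈ Set.Icc A B, ρ ≤ φ'' x) :
    ∀ I J : Set ℝ, I.OrdConnected → J.OrdConnected → I ⊆ Set.Icc 0 1 →
      J ⊆ Set.Icc A B →
      Tendsto
        (fun n : ℕ =>
          ((((Finset.Icc ⌈A * n⌉ ⌊B * n⌋).filter
              (fun k : ℤ => (k : ℝ) / n ∈ J ∧
                Int.fract ((n : ℝ) * φ ((k : ℝ) / n)) ∈ I)).card : ℝ) / n))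
        atTop (nhds ((volume I).toReal * (volume J).toReal)) := by
  intro I J hI hJ hI01 hJAB
  obtain ⟨a, b, ha, hab, hb, hI1, hI2, hIv⟩ := interval_ends 0 1 zero_le_one I hI hI01
  obtain ⟨a2, b2, ha2, hab2, hb2, hJ1, hJ2, hJv⟩ := interval_ends A B hAB J hJ hJAB
  rw [hIv, hJv]
  have hw := weyl_interval
    (fun n : ℕ => (Finset.Icc ⌈A * n⌉ ⌊B * n⌋).filter (fun k : ℤ => (k : ℝ) / n ∈ J))
    (fun n k => (n : ℝ) * φ ((k : ℝ) / n)) (b2 - a2)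
    (count_limit A B a2 b2 J ha2 hab2 hb2 hJ1 hJ2) ?_ a b ha hb hab I hI1 hI2
  · refine hw.congr fun n => ?_
    rw [Finset.filter_filter]
  · intro h hh
    rw [Metric.tendsto_nhds]
    intro ε hε
    have hh' : (0 : ℝ) < |(h : ℝ)| := abs_pos.2 (by exact_mod_cast hh)
    have hc := core A B (|(h : ℝ)| * ρ) hAB (by positivity) (fun t => h * φ t) (fun t => h * φ' t)
      (fun x hx => (hd1 x hx).const_mul _)
      (fun x hx => ((hd2 x hx).const_mul (h : ℝ)).continuousWithinAt)
      (fun x hx y hy => by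
        rw [← mul_sub, abs_mul, mul_assoc]
        exact mul_le_mul_of_nonneg_left (deriv_expand A B ρ φ' φ'' hd2 hconv x hx y hy) hh'.le)
      (ε / 2) (by positivity)
    filter_upwards [hc, eventually_gt_atTop 0] with n hn hn0
    have hn' : (0 : ℝ) < n := by exact_mod_cast hn0
    obtain ⟨p, q, hpq, hS⟩ := filter_eq_Ico A B J hJ n hn0
    have h1 := hn p q hpq (by
      intro k hk
      rw [← hS, Finset.mem_filter] at hk
      exact hJAB hk.2)
    rw [dist_zero_right, norm_div, Complex.norm_natCast, div_lt_iff₀ hn', hS]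
    have h2 : ∀ k : ℤ, (h : ℝ) * ((n : ℝ) * φ ((k : ℝ) / n)) = n * (h * φ ((k : ℝ) / n)) :=
      fun k => by ring
    simp only [h2]
    refine h1.trans_lt ?_
    gcongr
    linarith
end

section
/- Let h : ℝ → ℝ be twice continuously differentiable and odd, with h(t + 2π) = h(t) + 2kπ for some integer k and h''(t) > 0 for t ∈ (0, π). Let ψ be the inverse of h' on [h'(0), h'(π)], and for an integer ν with h'(0) < ν/n < h'(π) set t_{n,ν} = ψ(ν/n) and ρ_{n,ν} = n·h(t_{n,ν}) − ν·t_{n,ν}. Then for every fixed ε ∈ (0, π/2), (1/n) Σ_{ν ∈ ℤ : n h'(ε) ≤ ν ≤ n h'(π − ε)} (h''(t_{n,ν}))^{−1/2} · |cos(ρ_{n,ν} + π/4)| converges, as n → ∞, to (2/π) ∫_{ε}^{π−ε} √(h''(u)) du. -/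
open MeasureTheory Filter Set intervalIntegral
open scoped Real Topology


lemma sum_telescope {E : Type*} [AddCommGroup E] (w : ℤ → E) (p q : ℤ) (hpq : p ≤ q) :
    ∑ ν ∈ Finset.Ico p q, (w (ν + 1) - w ν) = w q - w p := by
  induction q, hpq using Int.leInduction with
  | base => simp
  | succ n hn ih =>
    have : Finset.Ico p (n+1) = insert n (Finset.Ico p n) := by
      ext x; simp; omega
    rw [this, Finset.sum_insert (by simp), ih]; abel

lemma Icc_eq_Ico_int (p q : ℤ) : Finset.Icc p q = Finset.Ico p (q + 1) := by
  ext x; simp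

lemma shift_bound (w : ℤ → ℂ) (C : ℝ) (hC : ∀ ν, ‖w ν‖ ≤ C) (p q : ℤ) (j : ℕ) :
    ‖∑ ν ∈ Finset.Icc p q, w (ν + j) - ∑ ν ∈ Finset.Icc p q, w ν‖ ≤ 2 * C * j := by
  have hC0 : 0 ≤ C := (norm_nonneg _).trans (hC 0)
  rcases le_or_gt p (q + 1) with h | h
  · induction j with
    | zero => simp
    | succ j ih =>
      have h1 := sum_telescope (fun ν => w (ν + j)) p (q + 1) h
      rw [← Icc_eq_Ico_int, Finset.sum_sub_distrib] at h1
      have h2 : ∑ ν ∈ Finset.Icc p q, w (ν + (j + 1 : ℕ)) - ∑ ν ∈ Finset.Icc p q, w ν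
        = (w (q + 1 + j) - w (p + j)) + (∑ ν ∈ Finset.Icc p q, w (ν + j) - ∑ ν ∈ Finset.Icc p q, w ν) := by
        rw [← h1]
        have : ∀ ν : ℤ, ν + ((j + 1 : ℕ) : ℤ) = ν + 1 + j := by intro ν; push_cast; ring
        simp only [this]; ring
      rw [h2]
      refine (norm_add_le _ _).trans ?_
      have h3 := norm_sub_le (w (q + 1 + j)) (w (p + j))
      have := hC (q + 1 + j)
      have := hC (p + j)
      push_cast
      linarith
  · rw [Finset.Icc_eq_empty (by omega)]
    simp; positivity

/-- index set -/
noncomputable def idx (a b : ℝ) (n : ℕ) : Finset ℤ := Finset.Icc ⌈(n : ℝ) * a⌉ ⌊(n : ℝ) * b⌋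

lemma idx_mem {a b : ℝ} {n : ℕ} (hn : 0 < n) {ν : ℤ} (h : ν ∈ idx a b n) :
    (ν : ℝ) / n ∈ Icc a b := by
  have hn' : (0 : ℝ) < n := by exact_mod_cast hn
  simp only [idx, Finset.mem_Icc, Int.ceil_le, Int.le_floor] at h
  constructor
  · rw [le_div_iff₀ hn']; linarith [h.1]
  · rw [div_le_iff₀ hn']; linarith [h.2]

lemma idx_card {a b : ℝ} (hab : a ≤ b) {n : ℕ} (hn : 0 < n) :
    ((idx a b n).card : ℝ) / n ≤ b - a + 1 := by
  have hn' : (1 : ℝ) ≤ n := by exact_mod_cast hn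
  rw [div_le_iff₀ (by linarith), idx, Int.card_Icc]
  have h1 := Int.le_ceil ((n : ℝ) * a)
  have h2 := Int.floor_le ((n : ℝ) * b)
  have h3 : (((⌊(n : ℝ) * b⌋ + 1 - ⌈(n : ℝ) * a⌉).toNat : ℤ) : ℝ) ≤ (n * b + 1 - n * a) := by
    rw [Int.toNat_eq_max]
    push_cast
    apply max_le
    · linarith
    · nlinarith
  rw [Int.cast_natCast] at h3
  nlinarith

lemma riemann {a b : ℝ} (hab : a ≤ b) (G : ℝ → ℝ) (hG : Continuous G) :
    Tendsto (fun n : ℕ => (1 / (n : ℝ)) * ∑ ν ∈ idx a b n, G ((ν : ℝ) / n)) atTop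
      (𝓝 (∫ x in a..b, G x)) := by
  have hceil : Tendsto (fun n : ℕ => ((⌈(n : ℝ) * a⌉ : ℤ) : ℝ) / n) atTop (𝓝 a) := by
    rw [tendsto_iff_norm_sub_tendsto_zero]
    refine squeeze_zero' (Eventually.of_forall fun _ => norm_nonneg _) ?_ tendsto_one_div_atTop_nhds_zero_nat
    filter_upwards [eventually_gt_atTop 0] with n hn
    have hn' : (0 : ℝ) < n := by exact_mod_cast hn
    have h1 := Int.le_ceil ((n : ℝ) * a)
    have h2 := Int.ceil_lt_add_one ((n : ℝ) * a)
    have : (⌈(n : ℝ) * a⌉ : ℝ) / n - a = (⌈(n : ℝ) * a⌉ - n * a) / n := by field_simp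
    rw [this, Real.norm_eq_abs, abs_div, abs_of_pos hn']
    gcongr
    rw [abs_le]; constructor <;> linarith
  have hfl : Tendsto (fun n : ℕ => ((⌊(n : ℝ) * b⌋ + 1 : ℤ) : ℝ) / n) atTop (𝓝 b) := by
    rw [tendsto_iff_norm_sub_tendsto_zero]
    refine squeeze_zero' (Eventually.of_forall fun _ => norm_nonneg _) ?_ tendsto_one_div_atTop_nhds_zero_nat
    filter_upwards [eventually_gt_atTop 0] with n hn
    have hn' : (0 : ℝ) < n := by exact_mod_cast hn
    have h1 := Int.floor_le ((n : ℝ) * b)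
    have h2 := Int.lt_floor_add_one ((n : ℝ) * b)
    have : ((⌊(n : ℝ) * b⌋ + 1 : ℤ) : ℝ) / n - b = (((⌊(n : ℝ) * b⌋ + 1 : ℤ) : ℝ) - n * b) / n := by field_simp
    rw [this, Real.norm_eq_abs, abs_div, abs_of_pos hn']
    gcongr
    push_cast
    rw [abs_le]; constructor <;> linarith
  have hcont : Continuous (fun y : ℝ => ∫ x in (0 : ℝ)..y, G x) :=
    intervalIntegral.continuous_primitive (fun a b => hG.intervalIntegrable a b) 0
  have hint : Tendsto (fun n : ℕ => (∫ x in (0 : ℝ)..(((⌊(n : ℝ) * b⌋ + 1 : ℤ) : ℝ) / n), G x) -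
      ∫ x in (0 : ℝ)..(((⌈(n : ℝ) * a⌉ : ℤ) : ℝ) / n), G x) atTop (𝓝 (∫ x in a..b, G x)) := by
    have := ((hcont.tendsto b).comp hfl).sub ((hcont.tendsto a).comp hceil)
    rw [intervalIntegral.integral_interval_sub_left (hG.intervalIntegrable _ _) (hG.intervalIntegrable _ _)] at this
    exact this
  suffices hs : Tendsto (fun n : ℕ => (1 / (n : ℝ)) * ∑ ν ∈ idx a b n, G ((ν : ℝ) / n) -
      ((∫ x in (0 : ℝ)..(((⌊(n : ℝ) * b⌋ + 1 : ℤ) : ℝ) / n), G x) -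
      ∫ x in (0 : ℝ)..(((⌈(n : ℝ) * a⌉ : ℤ) : ℝ) / n), G x)) atTop (𝓝 0) by
    simpa using hs.add hint
  rw [Metric.tendsto_atTop']
  intro η hη
  have huc := (isCompact_Icc (a := a) (b := b + 1)).uniformContinuousOn_of_continuous hG.continuousOn
  rw [Metric.uniformContinuousOn_iff] at huc
  set δ := η / (2 * (b - a + 1)) with hδ
  have hba : 0 < b - a + 1 := by linarith
  have hδ0 : 0 < δ := by positivity
  obtain ⟨r, hr, hru⟩ := huc δ hδ0
  obtain ⟨N, hN⟩ := exists_nat_gt (1 / r)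
  refine ⟨N, fun n hn => ?_⟩
  have hn0 : 0 < n := by omega
  have hn' : (0 : ℝ) < n := by exact_mod_cast hn0
  have hn1 : (1 : ℝ) ≤ n := by exact_mod_cast hn0
  have hnr : 1 / (n : ℝ) < r := by
    rw [div_lt_comm₀ hn' hr]
    exact hN.trans (by exact_mod_cast hn)
  have hpq : ⌈(n : ℝ) * a⌉ ≤ ⌊(n : ℝ) * b⌋ + 1 := by
    rw [Int.ceil_le]
    have h2 := Int.lt_floor_add_one ((n : ℝ) * b)
    push_cast
    nlinarith
  have htel := sum_telescope (fun ν : ℤ => ∫ x in (0 : ℝ)..((ν : ℝ) / n), G x) _ _ hpq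
  rw [← Icc_eq_Ico_int] at htel
  rw [dist_zero_right, ← htel, Finset.mul_sum]
  change ‖_ - ∑ ν ∈ idx a b n, _‖ < η
  rw [← Finset.sum_sub_distrib]
  have hterm : ∀ ν ∈ idx a b n, ‖1 / (n : ℝ) * G ((ν : ℝ) / n) -
      ((∫ x in (0 : ℝ)..(((ν + 1 : ℤ) : ℝ) / n), G x) - ∫ x in (0 : ℝ)..((ν : ℝ) / n), G x)‖ ≤ δ * (1 / n) := by
    intro ν hν
    have hmem := idx_mem hn0 hν
    rw [intervalIntegral.integral_interval_sub_left (hG.intervalIntegrable _ _) (hG.intervalIntegrable _ _)]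
    have e1 : ((ν + 1 : ℤ) : ℝ) / n - (ν : ℝ) / n = 1 / n := by push_cast; ring
    have e2 : 1 / (n : ℝ) * G ((ν : ℝ) / n) = ∫ x in ((ν : ℝ) / n)..(((ν + 1 : ℤ) : ℝ) / n), G ((ν : ℝ) / n) := by
      rw [intervalIntegral.integral_const, e1, smul_eq_mul]
    rw [e2, ← intervalIntegral.integral_sub (by simp) (hG.intervalIntegrable _ _)]
    have := intervalIntegral.norm_integral_le_of_norm_le_const (a := (ν : ℝ) / n) (b := ((ν + 1 : ℤ) : ℝ) / n)
      (f := fun x => G ((ν : ℝ) / n) - G x) (C := δ) ?_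
    · rw [e1, abs_of_pos (by positivity)] at this
      exact this
    · intro x hx
      have e3 : ((ν + 1 : ℤ) : ℝ) / n = (ν : ℝ) / n + 1 / n := by linarith
      have e4 : 0 < 1 / (n : ℝ) := by positivity
      have e5 : 1 / (n : ℝ) ≤ 1 := by rw [div_le_one hn']; exact hn1
      rw [e3, uIoc_of_le (by linarith)] at hx
      have := hru ((ν : ℝ) / n) ⟨hmem.1, by linarith [hmem.2]⟩ x ⟨by linarith [hx.1, hmem.1], by linarith [hx.2, hmem.2]⟩
        (by rw [Real.dist_eq, abs_lt]; constructor <;> linarith [hx.1, hx.2])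
      rw [Real.dist_eq] at this
      exact this.le
  refine (norm_sum_le_of_le _ hterm).trans_lt ?_
  rw [Finset.sum_const, nsmul_eq_mul]
  have hc := idx_card hab hn0
  calc ((idx a b n).card : ℝ) * (δ * (1 / n)) = ((idx a b n).card : ℝ) / n * δ := by ring
    _ ≤ (b - a + 1) * δ := by gcongr
    _ = η / 2 := by rw [hδ]; field_simp
    _ < η := by linarith

/-- Dirichlet-type average. -/
noncomputable def DK (K : ℕ) (θ : ℝ) : ℂ :=
  (1 / (K : ℂ)) * ∑ j ∈ Finset.range K, Complex.exp (Complex.I * ((j * θ : ℝ) : ℂ))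

lemma DK_continuous (K : ℕ) : Continuous (DK K) := by
  unfold DK; fun_prop

lemma DK_norm_le (K : ℕ) (θ : ℝ) : ‖DK K θ‖ ≤ 1 := by
  unfold DK
  rw [norm_mul]
  have : ‖∑ j ∈ Finset.range K, Complex.exp (Complex.I * ((j * θ : ℝ) : ℂ))‖ ≤ K := by
    refine (norm_sum_le _ _).trans ?_
    simp only [Complex.norm_exp_I_mul_ofReal]
    simp
  rw [norm_div, norm_one, Complex.norm_natCast, div_mul_eq_mul_div, one_mul]
  exact div_le_one_of_le₀ this (by positivity)

lemma DK_tendsto (θ : ℝ) (hθ : Complex.exp (Complex.I * θ) ≠ 1) :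
    Tendsto (fun K => ‖DK K θ‖) atTop (𝓝 0) := by
  have hx : 0 < ‖Complex.exp (Complex.I * θ) - 1‖ := norm_pos_iff.2 (sub_ne_zero.2 hθ)
  have h0 : Tendsto (fun K : ℕ => (1 / (K : ℝ)) * (2 / ‖Complex.exp (Complex.I * θ) - 1‖)) atTop (𝓝 0) := by
    simpa using tendsto_one_div_atTop_nhds_zero_nat.mul_const (2 / ‖Complex.exp (Complex.I * θ) - 1‖)
  refine squeeze_zero (fun _ => norm_nonneg _) (fun K => ?_) h0
  unfold DK
  have he : ∀ j : ℕ, Complex.exp (Complex.I * ((j * θ : ℝ) : ℂ)) = Complex.exp (Complex.I * θ) ^ j := by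
    intro j
    rw [← Complex.exp_nat_mul]; congr 1; push_cast; ring
  simp only [he]
  rw [geom_sum_eq hθ, norm_mul, norm_div, norm_div, norm_one, Complex.norm_natCast]
  gcongr
  refine (norm_sub_le _ _).trans ?_
  rw [norm_pow, Complex.norm_exp_I_mul_ofReal]; norm_num

lemma DK_integral {a b : ℝ} (hab : a ≤ b) (φ g : ℝ → ℝ) (hφ : Continuous φ) (hg : Continuous g)
    (hinj : InjOn φ (Icc a b)) :
    Tendsto (fun K => ∫ x in a..b, |g x| * ‖DK K (φ x)‖) atTop (𝓝 0) := by
  have hc : ∀ K, Continuous (fun x => |g x| * ‖DK K (φ x)‖) := fun K =>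
    hg.abs.mul ((DK_continuous K).comp hφ).norm
  have := intervalIntegral.tendsto_integral_filter_of_dominated_convergence (μ := volume) (a := a) (b := b)
    (l := atTop) (F := fun (K : ℕ) x => |g x| * ‖DK K (φ x)‖) (f := fun _ => 0) (fun x => |g x|)
    (Eventually.of_forall fun K => (hc K).aestronglyMeasurable) ?_ (hg.abs.intervalIntegrable _ _) ?_
  · simpa using this
  · refine Eventually.of_forall fun K => Eventually.of_forall fun x _ => ?_
    rw [Real.norm_of_nonneg (by positivity)]
    exact mul_le_of_le_one_right (abs_nonneg _) (DK_norm_le _ _)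
  · have hcount : ({x | x ∈ Icc a b ∧ Complex.exp (Complex.I * φ x) = 1} : Set ℝ).Countable := by
      have hr : (Set.range (fun m : ℤ => (m : ℝ) * (2 * π))).Countable := countable_range _
      refine MapsTo.countable_of_injOn (f := φ) (t := Set.range (fun m : ℤ => (m : ℝ) * (2 * π))) ?_
        (hinj.mono fun x hx => hx.1) hr
      rintro x ⟨_, hx⟩
      obtain ⟨m, hm⟩ := Complex.exp_eq_one_iff.1 hx
      refine ⟨m, ?_⟩
      have : Complex.I * (φ x : ℂ) = Complex.I * ((m * (2 * π) : ℝ) : ℂ) := by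
        rw [hm]; push_cast; ring
      exact_mod_cast (mul_left_cancel₀ Complex.I_ne_zero this).symm
    have hae := measure_eq_zero_iff_ae_notMem.1 (hcount.measure_zero volume)
    filter_upwards [hae] with x hx hxm
    rw [uIoc_of_le hab] at hxm
    have hne : Complex.exp (Complex.I * φ x) ≠ 1 := fun h => hx ⟨⟨hxm.1.le, hxm.2⟩, h⟩
    simpa using (DK_tendsto _ hne).const_mul |g x|

lemma weyl_sum {a b : ℝ} (hab : a ≤ b) (f φ g : ℝ → ℝ) (hφ : Continuous φ) (hg : Continuous g)
    (hf : ∀ x, HasDerivAt f (φ x) x) (hinj : InjOn φ (Icc a b)) (C : ℝ) (hC : ∀ x, |g x| ≤ C) :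
    Tendsto (fun n : ℕ => (1 / (n : ℂ)) * ∑ ν ∈ idx a b n, ((g ((ν : ℝ) / n) : ℝ) : ℂ) *
      Complex.exp (Complex.I * ((n * f ((ν : ℝ) / n) : ℝ) : ℂ))) atTop (𝓝 0) := by
  have hC0 : 0 ≤ C := (abs_nonneg _).trans (hC 0)
  rw [Metric.tendsto_atTop]
  intro η hη
  obtain ⟨K, hKint, hK0⟩ := (((DK_integral hab φ g hφ hg hinj).eventually (gt_mem_nhds (show 0 < η / 4 by linarith))).and
    (eventually_gt_atTop 0)).exists
  have hK' : (0 : ℝ) < K := by exact_mod_cast hK0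
  have hKne : (K : ℂ) ≠ 0 := by exact_mod_cast hK0.ne'
  have hR := riemann hab (fun x => |g x| * ‖DK K (φ x)‖) (hg.abs.mul ((DK_continuous K).comp hφ).norm)
  have hR' := hR.eventually (gt_mem_nhds hKint)
  have hba : 0 < b - a + 1 := by linarith
  set δ := η / (4 * (b - a + 1) * (1 + C * K)) with hδ
  have hδ0 : 0 < δ := by positivity
  have hucφ := (isCompact_Icc (a := a) (b := b + 1)).uniformContinuousOn_of_continuous hφ.continuousOn
  have hucg := (isCompact_Icc (a := a) (b := b + 1)).uniformContinuousOn_of_continuous hg.continuousOn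
  rw [Metric.uniformContinuousOn_iff] at hucφ hucg
  obtain ⟨r, hr, hru⟩ := hucφ δ hδ0
  obtain ⟨r', hr', hru'⟩ := hucg δ hδ0
  have t1 : Tendsto (fun n : ℕ => (K : ℝ) / n) atTop (𝓝 0) := tendsto_const_div_atTop_nhds_zero_nat _
  have t2 : Tendsto (fun n : ℕ => (2 * C * K : ℝ) / n) atTop (𝓝 0) := tendsto_const_div_atTop_nhds_zero_nat _
  rw [← eventually_atTop]
  filter_upwards [hR', t1.eventually (gt_mem_nhds hr), t1.eventually (gt_mem_nhds hr'),
    t1.eventually (gt_mem_nhds one_pos), t2.eventually (gt_mem_nhds (show 0 < η / 4 by linarith)),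
    eventually_gt_atTop 0] with n hn1 hn2 hn3 hn4 hn5 hn0
  have hn' : (0 : ℝ) < n := by exact_mod_cast hn0
  rw [dist_zero_right]
  set z : ℤ → ℂ := fun ν => ((g ((ν : ℝ) / n) : ℝ) : ℂ) *
      Complex.exp (Complex.I * ((n * f ((ν : ℝ) / n) : ℝ) : ℂ)) with hz
  have hzC : ∀ ν, ‖z ν‖ ≤ C := by
    intro ν
    rw [hz]; simp only
    rw [norm_mul, Complex.norm_exp_I_mul_ofReal, mul_one, Complex.norm_real]
    exact hC _
  -- step 1 : averaging
  have s1 : ‖∑ ν ∈ idx a b n, z ν - (1 / (K : ℂ)) * ∑ j ∈ Finset.range K, ∑ ν ∈ idx a b n, z (ν + j)‖ ≤ 2 * C * K := by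
    have e : ∑ ν ∈ idx a b n, z ν - (1 / (K : ℂ)) * ∑ j ∈ Finset.range K, ∑ ν ∈ idx a b n, z (ν + j)
      = -((1 / (K : ℂ)) * ∑ j ∈ Finset.range K, (∑ ν ∈ idx a b n, z (ν + j) - ∑ ν ∈ idx a b n, z ν)) := by
      rw [Finset.sum_sub_distrib, Finset.sum_const, Finset.card_range, nsmul_eq_mul]
      field_simp
      ring
    rw [e, norm_neg, norm_mul, norm_div, norm_one, Complex.norm_natCast]
    have : ‖∑ j ∈ Finset.range K, (∑ ν ∈ idx a b n, z (ν + j) - ∑ ν ∈ idx a b n, z ν)‖ ≤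
        ∑ j ∈ Finset.range K, 2 * C * K := by
      refine norm_sum_le_of_le _ fun j hj => ?_
      refine (shift_bound z C hzC _ _ j).trans ?_
      have : (j : ℝ) ≤ K := by exact_mod_cast (Finset.mem_range.1 hj).le
      gcongr
    rw [Finset.sum_const, Finset.card_range, nsmul_eq_mul] at this
    calc _ ≤ 1 / (K : ℝ) * (K * (2 * C * K)) := by gcongr
      _ = _ := by field_simp
  -- step 2 : local linearisation
  have s2 : ∀ ν ∈ idx a b n, ∀ j ∈ Finset.range K,
      ‖z (ν + j) - z ν * Complex.exp (Complex.I * ((j * φ ((ν : ℝ) / n) : ℝ) : ℂ))‖ ≤ δ * (1 + C * K) := by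
    intro ν hν j hj
    have hmem := idx_mem hn0 hν
    have hjK : (j : ℝ) ≤ K := by exact_mod_cast (Finset.mem_range.1 hj).le
    set x := (ν : ℝ) / n with hx
    set y := ((ν + j : ℤ) : ℝ) / n with hy
    have hyx : y = x + j / n := by rw [hy, hx]; push_cast; ring
    have hjn : (j : ℝ) / n ≤ K / n := by gcongr
    have hjn0 : 0 ≤ (j : ℝ) / n := by positivity
    have hgd : |g y - g x| ≤ δ := by
      have := hru' y ⟨by linarith [hmem.1], by linarith [hmem.2]⟩ x ⟨hmem.1, by linarith [hmem.2]⟩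
        (by rw [Real.dist_eq, abs_lt]; constructor <;> linarith)
      rw [Real.dist_eq] at this; exact this.le
    have hfd : |n * f y - n * f x - j * φ x| ≤ δ * K := by
      have := Convex.norm_image_sub_le_of_norm_hasDerivWithin_le (𝕜 := ℝ) (f := fun t => f t - φ x * t)
        (f' := fun t => φ t - φ x) (s := Icc x y) (x := x) (y := y) (C := δ)
        (fun t _ => by simpa using ((hf t).fun_sub ((hasDerivAt_id t).const_mul (φ x))).hasDerivWithinAt)
        (fun t ht => by
          have := hru t ⟨by linarith [hmem.1, ht.1], by linarith [hmem.2, ht.2]⟩ x ⟨hmem.1, by linarith [hmem.2]⟩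
            (by rw [Real.dist_eq, abs_lt]; constructor <;> linarith [ht.1, ht.2])
          rw [Real.dist_eq] at this; exact this.le)
        (convex_Icc _ _) ⟨le_rfl, by linarith⟩ ⟨by linarith, le_rfl⟩
      have e1 : n * f y - n * f x - j * φ x = n * ((f y - φ x * y) - (f x - φ x * x)) := by
        rw [hyx]; field_simp; ring
      rw [e1, abs_mul, abs_of_pos hn']
      have e2 : ‖y - x‖ = j / n := by
        rw [hyx, add_sub_cancel_left, Real.norm_of_nonneg hjn0]
      rw [e2] at this
      calc _ ≤ n * (δ * (j / n)) := by gcongr; exact this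
        _ = δ * j := by field_simp
        _ ≤ δ * K := by gcongr
    have key : z (ν + j) - z ν * Complex.exp (Complex.I * ((j * φ x : ℝ) : ℂ))
      = ((g y - g x : ℝ) : ℂ) * Complex.exp (Complex.I * ((n * f y : ℝ) : ℂ)) +
        (g x : ℂ) * (Complex.exp (Complex.I * ((n * f x + j * φ x : ℝ) : ℂ)) *
          (Complex.exp (Complex.I * ((n * f y - n * f x - j * φ x : ℝ) : ℂ)) - 1)) := by
      rw [mul_sub, ← Complex.exp_add, mul_one]
      have : Complex.I * ((n * f x + j * φ x : ℝ) : ℂ) + Complex.I * ((n * f y - n * f x - j * φ x : ℝ) : ℂ)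
        = Complex.I * ((n * f y : ℝ) : ℂ) := by push_cast; ring
      rw [this]
      have h2 : Complex.exp (Complex.I * ((n * f x + j * φ x : ℝ) : ℂ)) =
        Complex.exp (Complex.I * ((n * f x : ℝ) : ℂ)) * Complex.exp (Complex.I * ((j * φ x : ℝ) : ℂ)) := by
        rw [← Complex.exp_add]; congr 1; push_cast; ring
      rw [h2]
      simp only [hz, ← hx, ← hy]
      push_cast; ring
    rw [key]
    refine (norm_add_le _ _).trans ?_
    rw [norm_mul, norm_mul, norm_mul, Complex.norm_exp_I_mul_ofReal, Complex.norm_exp_I_mul_ofReal, mul_one, one_mul,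
      Complex.norm_real, Complex.norm_real, Real.norm_eq_abs, Real.norm_eq_abs]
    have h3 := (Real.norm_exp_I_mul_ofReal_sub_one_le (x := n * f y - n * f x - j * φ x))
    rw [Real.norm_eq_abs] at h3
    have h4 := h3.trans hfd
    calc _ ≤ δ + C * (δ * K) := by gcongr; exact hC _
      _ = _ := by ring
  -- step 3 : combine
  have s3 : ‖(1 / (K : ℂ)) * ∑ j ∈ Finset.range K, ∑ ν ∈ idx a b n, z (ν + j) -
      ∑ ν ∈ idx a b n, z ν * DK K (φ ((ν : ℝ) / n))‖ ≤ (idx a b n).card * (δ * (1 + C * K)) := by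
    have e : (1 / (K : ℂ)) * ∑ j ∈ Finset.range K, ∑ ν ∈ idx a b n, z (ν + j) -
      ∑ ν ∈ idx a b n, z ν * DK K (φ ((ν : ℝ) / n)) = ∑ ν ∈ idx a b n, (1 / (K : ℂ)) * ∑ j ∈ Finset.range K,
        (z (ν + j) - z ν * Complex.exp (Complex.I * ((j * φ ((ν : ℝ) / n) : ℝ) : ℂ))) := by
      rw [Finset.sum_comm, Finset.mul_sum, ← Finset.sum_sub_distrib]
      refine Finset.sum_congr rfl fun ν _ => ?_
      rw [Finset.sum_sub_distrib, ← Finset.mul_sum, DK]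
      ring
    rw [e, ← nsmul_eq_mul, ← Finset.sum_const]
    refine norm_sum_le_of_le _ fun ν hν => ?_
    rw [norm_mul, norm_div, norm_one, Complex.norm_natCast]
    have := norm_sum_le_of_le _ (s2 ν hν)
    rw [Finset.sum_const, Finset.card_range, nsmul_eq_mul] at this
    calc _ ≤ 1 / (K : ℝ) * (K * (δ * (1 + C * K))) := by gcongr
      _ = _ := by field_simp
  have s4 : ‖∑ ν ∈ idx a b n, z ν * DK K (φ ((ν : ℝ) / n))‖ ≤
      ∑ ν ∈ idx a b n, |g ((ν : ℝ) / n)| * ‖DK K (φ ((ν : ℝ) / n))‖ := by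
    refine norm_sum_le_of_le _ fun ν _ => ?_
    rw [hz]; simp only
    rw [norm_mul, norm_mul, Complex.norm_exp_I_mul_ofReal, mul_one, Complex.norm_real, Real.norm_eq_abs]
  have s5 : ‖∑ ν ∈ idx a b n, z ν‖ ≤ 2 * C * K + (idx a b n).card * (δ * (1 + C * K)) +
      ∑ ν ∈ idx a b n, |g ((ν : ℝ) / n)| * ‖DK K (φ ((ν : ℝ) / n))‖ := by
    have := norm_add₃_le (a := ∑ ν ∈ idx a b n, z ν - (1 / (K : ℂ)) * ∑ j ∈ Finset.range K, ∑ ν ∈ idx a b n, z (ν + j))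
      (b := (1 / (K : ℂ)) * ∑ j ∈ Finset.range K, ∑ ν ∈ idx a b n, z (ν + j) -
      ∑ ν ∈ idx a b n, z ν * DK K (φ ((ν : ℝ) / n))) (c := ∑ ν ∈ idx a b n, z ν * DK K (φ ((ν : ℝ) / n)))
    rw [sub_add_sub_cancel, sub_add_cancel] at this
    linarith
  rw [norm_mul, norm_div, norm_one, Complex.norm_natCast]
  have hcard := idx_card hab hn0
  have h6 : ((idx a b n).card : ℝ) / n * (δ * (1 + C * K)) ≤ η / 4 := by
    calc _ ≤ (b - a + 1) * (δ * (1 + C * K)) := by gcongr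
      _ = η / 4 := by rw [hδ]; field_simp
  calc _ ≤ 1 / (n : ℝ) * (2 * C * K + (idx a b n).card * (δ * (1 + C * K)) +
      ∑ ν ∈ idx a b n, |g ((ν : ℝ) / n)| * ‖DK K (φ ((ν : ℝ) / n))‖) := by gcongr
    _ = 2 * C * K / n + ((idx a b n).card : ℝ) / n * (δ * (1 + C * K)) + 1 / (n : ℝ) *
      ∑ ν ∈ idx a b n, |g ((ν : ℝ) / n)| * ‖DK K (φ ((ν : ℝ) / n))‖ := by ring
    _ < η := by linarith

instance fact_pi_pos : Fact (0 < π) := ⟨Real.pi_pos⟩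

lemma equi_span {a b : ℝ} (hab : a ≤ b) (f φ g : ℝ → ℝ) (hφ : Continuous φ) (hg : Continuous g)
    (hf : ∀ x, HasDerivAt f (φ x) x) (hinj : InjOn φ (Icc a b)) (C : ℝ) (hC : ∀ x, |g x| ≤ C)
    (P : C(AddCircle π, ℂ)) (hP : P ∈ Submodule.span ℂ (Set.range (fourier (T := π)))) :
    Tendsto (fun n : ℕ => (1 / (n : ℂ)) * ∑ ν ∈ idx a b n, ((g ((ν : ℝ) / n) : ℝ) : ℂ) *
      P ((n * f ((ν : ℝ) / n) : ℝ) : AddCircle π)) atTop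
      (𝓝 (((∫ x in a..b, g x : ℝ) : ℂ) * fourierCoeff P 0)) := by
  induction hP using Submodule.span_induction with
  | mem x hx =>
    obtain ⟨m, rfl⟩ := hx
    rw [fourierCoeff_fourier]
    by_cases hm : m = 0
    · subst hm
      simp only [fourier_zero, Pi.single_eq_same, mul_one]
      have := (Complex.continuous_ofReal.tendsto _).comp (riemann hab g hg)
      refine this.congr fun n => ?_
      simp
    · rw [Pi.single_eq_of_ne (Ne.symm hm), mul_zero]
      have hm' : (2 * m : ℝ) ≠ 0 := by simpa using hm
      have := weyl_sum hab (fun x => (2 * m) * f x) (fun x => (2 * m) * φ x) g (hφ.const_mul _) hg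
        (fun x => (hf x).const_mul _) (fun x hx y hy hxy => hinj hx hy (mul_left_cancel₀ hm' hxy)) C hC
      refine this.congr fun n => ?_
      congr 1
      refine Finset.sum_congr rfl fun ν _ => ?_
      rw [fourier_coe_apply]
      congr 2
      have : (π : ℂ) ≠ 0 := by exact_mod_cast Real.pi_ne_zero
      push_cast
      field_simp
  | zero => simp [fourierCoeff]
  | add x y _ _ hx hy =>
    have e : fourierCoeff (x + y : C(AddCircle π, ℂ)) 0 = fourierCoeff x 0 + fourierCoeff y 0 := by
      rw [ContinuousMap.coe_add, fourierCoeff.add]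
      · rfl
      · exact x.continuous.integrable_of_hasCompactSupport (HasCompactSupport.of_compactSpace _)
      · exact y.continuous.integrable_of_hasCompactSupport (HasCompactSupport.of_compactSpace _)
    rw [e, mul_add]
    refine (hx.add hy).congr fun n => ?_
    rw [← mul_add, ← Finset.sum_add_distrib]
    simp [mul_add]
  | smul c x _ hx =>
    have e : fourierCoeff (c • x : C(AddCircle π, ℂ)) 0 = c * fourierCoeff x 0 := by
      rw [ContinuousMap.coe_smul, fourierCoeff.const_smul]; rfl
    rw [e, mul_left_comm]
    refine (hx.const_mul c).congr fun n => ?_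
    rw [mul_left_comm, Finset.mul_sum]
    congr 1
    refine Finset.sum_congr rfl fun ν _ => ?_
    simp; ring

lemma fourierCoeff_zero_norm_sub (P Q : C(AddCircle π, ℂ)) :
    ‖fourierCoeff P 0 - fourierCoeff Q 0‖ ≤ ‖P - Q‖ := by
  have hi : ∀ P : C(AddCircle π, ℂ), Integrable P AddCircle.haarAddCircle := fun P =>
    P.continuous.integrable_of_hasCompactSupport (HasCompactSupport.of_compactSpace _)
  simp only [fourierCoeff, neg_zero, fourier_zero, one_smul]
  rw [← integral_sub (hi P) (hi Q)]
  have := norm_integral_le_of_norm_le_const (μ := (AddCircle.haarAddCircle : Measure (AddCircle π)))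
    (f := fun t => P t - Q t) (C := ‖P - Q‖) (Eventually.of_forall fun t => (P - Q).norm_coe_le_norm t)
  simpa using this

lemma equi {a b : ℝ} (hab : a ≤ b) (f φ g : ℝ → ℝ) (hφ : Continuous φ) (hg : Continuous g)
    (hf : ∀ x, HasDerivAt f (φ x) x) (hinj : InjOn φ (Icc a b)) (C : ℝ) (hC : ∀ x, |g x| ≤ C)
    (F : C(AddCircle π, ℂ)) :
    Tendsto (fun n : ℕ => (1 / (n : ℂ)) * ∑ ν ∈ idx a b n, ((g ((ν : ℝ) / n) : ℝ) : ℂ) *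
      F ((n * f ((ν : ℝ) / n) : ℝ) : AddCircle π)) atTop
      (𝓝 (((∫ x in a..b, g x : ℝ) : ℂ) * fourierCoeff F 0)) := by
  have hC0 : 0 ≤ C := (abs_nonneg _).trans (hC 0)
  have hba : 0 < b - a + 1 := by linarith
  rw [Metric.tendsto_atTop]
  intro η hη
  set M := C * (b - a + 1) + |∫ x in a..b, g x| + 1 with hM
  have hM0 : 0 < M := by positivity
  have hcl : F ∈ closure (Submodule.span ℂ (Set.range (fourier (T := π))) : Set C(AddCircle π, ℂ)) := by
    rw [← Submodule.topologicalClosure_coe, span_fourier_closure_eq_top]; trivial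
  obtain ⟨P, hP, hFP⟩ := Metric.mem_closure_iff.1 hcl (η / (2 * M)) (by positivity)
  rw [dist_eq_norm] at hFP
  have hT := equi_span hab f φ g hφ hg hf hinj C hC P hP
  rw [← eventually_atTop]
  filter_upwards [hT.eventually (Metric.ball_mem_nhds _ (half_pos hη)), eventually_gt_atTop 0] with n hn hn0
  have hn' : (0 : ℝ) < n := by exact_mod_cast hn0
  rw [dist_eq_norm] at hn
  rw [dist_eq_norm]
  set A := (1 / (n : ℂ)) * ∑ ν ∈ idx a b n, ((g ((ν : ℝ) / n) : ℝ) : ℂ) *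
      F ((n * f ((ν : ℝ) / n) : ℝ) : AddCircle π) with hA
  set B := (1 / (n : ℂ)) * ∑ ν ∈ idx a b n, ((g ((ν : ℝ) / n) : ℝ) : ℂ) *
      P ((n * f ((ν : ℝ) / n) : ℝ) : AddCircle π) with hB
  have h1 : ‖A - B‖ ≤ C * (b - a + 1) * ‖F - P‖ := by
    have e : A - B = (1 / (n : ℂ)) * ∑ ν ∈ idx a b n, ((g ((ν : ℝ) / n) : ℝ) : ℂ) *
        ((F - P) ((n * f ((ν : ℝ) / n) : ℝ) : AddCircle π)) := by
      rw [hA, hB, ← mul_sub, ← Finset.sum_sub_distrib]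
      simp [mul_sub]
    rw [e, norm_mul, norm_div, norm_one, Complex.norm_natCast]
    have : ‖∑ ν ∈ idx a b n, ((g ((ν : ℝ) / n) : ℝ) : ℂ) *
        ((F - P) ((n * f ((ν : ℝ) / n) : ℝ) : AddCircle π))‖ ≤ ∑ ν ∈ idx a b n, C * ‖F - P‖ := by
      refine norm_sum_le_of_le _ fun ν _ => ?_
      rw [norm_mul, Complex.norm_real]
      exact mul_le_mul (hC _) ((F - P).norm_coe_le_norm _) (norm_nonneg _) hC0
    rw [Finset.sum_const, nsmul_eq_mul] at this
    calc _ ≤ 1 / (n : ℝ) * ((idx a b n).card * (C * ‖F - P‖)) := by gcongr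
      _ = (idx a b n).card / n * (C * ‖F - P‖) := by ring
      _ ≤ (b - a + 1) * (C * ‖F - P‖) := by gcongr; exact idx_card hab hn0
      _ = _ := by ring
  have h2 : ‖((∫ x in a..b, g x : ℝ) : ℂ) * fourierCoeff P 0 - ((∫ x in a..b, g x : ℝ) : ℂ) * fourierCoeff F 0‖
      ≤ |∫ x in a..b, g x| * ‖F - P‖ := by
    rw [← mul_sub, norm_mul, Complex.norm_real, Real.norm_eq_abs, norm_sub_rev F P]
    gcongr
    exact fourierCoeff_zero_norm_sub P F
  have h3 : M * ‖F - P‖ < η / 2 := by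
    calc _ < M * (η / (2 * M)) := by gcongr
      _ = _ := by field_simp
  have h4 := norm_add₃_le (a := A - B) (b := B - ((∫ x in a..b, g x : ℝ) : ℂ) * fourierCoeff P 0)
    (c := ((∫ x in a..b, g x : ℝ) : ℂ) * fourierCoeff P 0 - ((∫ x in a..b, g x : ℝ) : ℂ) * fourierCoeff F 0)
  rw [sub_add_sub_cancel, sub_add_sub_cancel] at h4
  have h5 : C * (b - a + 1) * ‖F - P‖ + |∫ x in a..b, g x| * ‖F - P‖ ≤ M * ‖F - P‖ := by
    rw [hM]; nlinarith [norm_nonneg (F - P)]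
  linarith

lemma cos_periodic : Function.Periodic (fun x : ℝ => ((|Real.cos (x + π / 4)| : ℝ) : ℂ)) π := by
  intro x
  simp only
  rw [show x + π + π / 4 = x + π / 4 + π by ring, Real.cos_add_pi, abs_neg]

/-- `|cos(x+π/4)|` on the circle. -/
noncomputable def cosF : C(AddCircle π, ℂ) where
  toFun := cos_periodic.lift
  continuous_toFun := by
    refine continuous_coinduced_dom.2 ?_
    change Continuous (fun x : ℝ => ((|Real.cos (x + π / 4)| : ℝ) : ℂ))
    fun_prop

lemma cosF_coe (x : ℝ) : cosF (x : AddCircle π) = ((|Real.cos (x + π / 4)| : ℝ) : ℂ) := rfl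

lemma cosF_coeff : fourierCoeff cosF 0 = ((2 / π : ℝ) : ℂ) := by
  rw [fourierCoeff_eq_intervalIntegral _ _ (-(π / 2) - π / 4)]
  simp only [neg_zero, fourier_zero, one_smul, cosF_coe]
  rw [intervalIntegral.integral_ofReal]
  have : ∫ x in (-(π / 2) - π / 4)..(-(π / 2) - π / 4 + π), |Real.cos (x + π / 4)| = 2 := by
    rw [intervalIntegral.integral_comp_add_right (fun x => |Real.cos x|)]
    rw [show -(π / 2) - π / 4 + π / 4 = -(π / 2) by ring, show -(π / 2) - π / 4 + π + π / 4 = π / 2 by ring]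
    rw [intervalIntegral.integral_congr (g := Real.cos)]
    · rw [integral_cos]; simp; norm_num
    · intro x hx
      rw [uIcc_of_le (by linarith [Real.pi_pos])] at hx
      exact abs_of_nonneg (Real.cos_nonneg_of_mem_Icc hx)
  rw [this]
  simp
  ring

lemma equi_cos {a b : ℝ} (hab : a ≤ b) (f φ g : ℝ → ℝ) (hφ : Continuous φ) (hg : Continuous g)
    (hf : ∀ x, HasDerivAt f (φ x) x) (hinj : InjOn φ (Icc a b)) (C : ℝ) (hC : ∀ x, |g x| ≤ C) :
    Tendsto (fun n : ℕ => (1 / (n : ℝ)) * ∑ ν ∈ idx a b n, g ((ν : ℝ) / n) *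
      |Real.cos (n * f ((ν : ℝ) / n) + π / 4)|) atTop
      (𝓝 ((2 / π) * ∫ x in a..b, g x)) := by
  have := equi hab f φ g hφ hg hf hinj C hC cosF
  rw [cosF_coeff] at this
  have h2 := (Complex.continuous_re.tendsto _).comp this
  have e : (((∫ x in a..b, g x : ℝ) : ℂ) * ((2 / π : ℝ) : ℂ)).re = (2 / π) * ∫ x in a..b, g x := by
    rw [← Complex.ofReal_mul, Complex.ofReal_re, mul_comm]
  rw [e] at h2
  refine h2.congr fun n => ?_
  simp only [Function.comp, cosF_coe]
  rw [← Complex.ofReal_re (1 / (n : ℝ) * _)]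
  congr 1
  push_cast
  rfl

/-- Final step: for every fixed `ε ∈ (0, π/2)`, the normalized sums
`(1/n) ∑_{n h'(ε) ≤ ν ≤ n h'(π-ε)} h''(t_{n,ν})^{-1/2} |cos(ρ_{n,ν} + π/4)|`
converge to `(2/π) ∫_ε^{π-ε} √(h''(u)) du`, where `t_{n,ν} = ψ(ν/n)` and
`ρ_{n,ν} = n h(t_{n,ν}) - ν t_{n,ν}`. -/
theorem central_sums_tendsto
    (h : ℝ → ℝ) (hreg : ContDiff ℝ 2 h)
    (hper : ∃ k : ℤ, ∀ t : ℝ, h (t + 2 * π) = h t + 2 * (k : ℝ) * π)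
    (hodd : ∀ t : ℝ, h (-t) = -h t)
    (hpos : ∀ t ∈ Set.Ioo (0 : ℝ) π, 0 < deriv (deriv h) t)
    (ψ : ℝ → ℝ)
    (hψmem : ∀ x ∈ Set.Icc (deriv h 0) (deriv h π), ψ x ∈ Set.Icc (0 : ℝ) π)
    (hψright : ∀ x ∈ Set.Icc (deriv h 0) (deriv h π), deriv h (ψ x) = x)
    (hψleft : ∀ u ∈ Set.Icc (0 : ℝ) π, ψ (deriv h u) = u)
    (ε : ℝ) (hε : 0 < ε) (hεπ : ε < π / 2) :
    Tendsto
      (fun n : ℕ => (1 / (n : ℝ)) *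
        ∑ ν ∈ Finset.Icc ⌈(n : ℝ) * deriv h ε⌉ ⌊(n : ℝ) * deriv h (π - ε)⌋,
          (Real.sqrt (deriv (deriv h) (ψ ((ν : ℝ) / n))))⁻¹ *
            |Real.cos ((n : ℝ) * h (ψ ((ν : ℝ) / n)) - (ν : ℝ) * ψ ((ν : ℝ) / n) +
              π / 4)|)
      atTop
      (nhds ((2 / π) * ∫ u in ε..(π - ε), Real.sqrt (deriv (deriv h) u))) := by
  have hπ := Real.pi_pos
  set a := deriv h ε with ha
  set b := deriv h (π - ε) with hb
  have hd1 : Differentiable ℝ h := hreg.differentiable (by norm_num)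
  have hreg1 : ContDiff ℝ 1 (deriv h) := by
    have : ContDiff ℝ (1 + 1) h := by simpa [one_add_one_eq_two] using hreg
    exact ((contDiff_succ_iff_deriv.1 this).2).2
  have hd2 : Differentiable ℝ (deriv h) := hreg1.differentiable (by norm_num)
  have hc2 : Continuous (deriv (deriv h)) := hreg1.continuous_deriv (by norm_num)
  have hmono : StrictMonoOn (deriv h) (Icc 0 π) := by
    refine strictMonoOn_of_deriv_pos (convex_Icc _ _) hd2.continuous.continuousOn ?_
    rw [interior_Icc]; exact hpos
  have mε : ε ∈ Icc 0 π := ⟨hε.le, by linarith⟩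
  have mε' : π - ε ∈ Icc 0 π := ⟨by linarith, by linarith⟩
  have hab : a < b := hmono mε mε' (by linarith)
  have ha0 : deriv h 0 ≤ a := (hmono.le_iff_le ⟨le_rfl, hπ.le⟩ mε).2 hε.le
  have hbπ : b ≤ deriv h π := (hmono.le_iff_le mε' ⟨hπ.le, le_rfl⟩).2 (by linarith)
  have hsub : ∀ x ∈ Icc a b, x ∈ Icc (deriv h 0) (deriv h π) := fun x hx =>
    ⟨ha0.trans hx.1, hx.2.trans hbπ⟩
  have hψI : ∀ x ∈ Icc a b, ψ x ∈ Icc ε (π - ε) := by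
    intro x hx
    have h1 := hψmem x (hsub x hx)
    have h2 := hψright x (hsub x hx)
    constructor
    · rw [← hmono.le_iff_le mε h1, h2]; exact hx.1
    · rw [← hmono.le_iff_le h1 mε', h2]; exact hx.2
  have hposI : ∀ u ∈ Icc ε (π - ε), 0 < deriv (deriv h) u := fun u hu =>
    hpos u ⟨by linarith [hu.1], by linarith [hu.2]⟩
  obtain ⟨c, hc, hcle⟩ : ∃ c > 0, ∀ u ∈ Icc ε (π - ε), c ≤ deriv (deriv h) u := by
    obtain ⟨u, hu, hmin⟩ := (isCompact_Icc (a := ε) (b := π - ε)).exists_isMinOn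
      (nonempty_Icc.2 (by linarith)) hc2.continuousOn
    exact ⟨_, hposI u hu, fun v hv => hmin hv⟩
  have hexp : ∀ u ∈ Icc ε (π - ε), ∀ v ∈ Icc ε (π - ε), u ≤ v → c * (v - u) ≤ deriv h v - deriv h u :=
    Convex.mul_sub_le_image_sub_of_le_deriv (convex_Icc _ _) hd2.continuous.continuousOn
      hd2.differentiableOn (fun x hx => hcle x (interior_subset hx))
  have hexp' : ∀ u ∈ Icc ε (π - ε), ∀ v ∈ Icc ε (π - ε), c * |u - v| ≤ |deriv h u - deriv h v| := by
    intro u hu v hv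
    rcases le_total u v with huv | huv
    · rw [abs_sub_comm u, abs_sub_comm (deriv h u), abs_of_nonneg (sub_nonneg.2 huv)]
      exact (hexp u hu v hv huv).trans (le_abs_self _)
    · rw [abs_of_nonneg (sub_nonneg.2 huv)]
      exact (hexp v hv u hu huv).trans (le_abs_self _)
  have hψc : ContinuousOn ψ (Icc a b) := by
    refine (LipschitzOnWith.of_dist_le_mul (K := Real.toNNReal c⁻¹) fun x hx y hy => ?_).continuousOn
    rw [Real.coe_toNNReal _ (by positivity), Real.dist_eq, Real.dist_eq]
    have := hexp' _ (hψI x hx) _ (hψI y hy)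
    rw [hψright x (hsub x hx), hψright y (hsub y hy)] at this
    rw [inv_mul_eq_div, le_div_iff₀ hc]; linarith
  set p : ℝ → ℝ := fun x => max a (min b x) with hp
  have hpc : Continuous p := by rw [hp]; fun_prop
  have hpI : ∀ x, p x ∈ Icc a b := fun x => ⟨le_max_left _ _, max_le hab.le (min_le_left _ _)⟩
  have hpid : ∀ x ∈ Icc a b, p x = x := fun x hx => by
    simp only [hp]; rw [min_eq_right hx.2, max_eq_right hx.1]
  have hψp : Continuous (fun x => ψ (p x)) := hψc.comp_continuous hpc hpI
  set g : ℝ → ℝ := fun x => (Real.sqrt (deriv (deriv h) (ψ (p x))))⁻¹ with hg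
  have hgc : Continuous g := by
    refine Continuous.inv₀ (Real.continuous_sqrt.comp (hc2.comp hψp)) fun x => ?_
    exact (Real.sqrt_pos.2 (hposI _ (hψI _ (hpI x)))).ne'
  have hgC : ∀ x, |g x| ≤ (Real.sqrt c)⁻¹ := by
    intro x
    rw [abs_of_nonneg (by positivity)]
    have := Real.sqrt_pos.2 hc
    exact inv_anti₀ this (Real.sqrt_le_sqrt (hcle _ (hψI _ (hpI x))))
  set f0 : ℝ → ℝ := fun x => h (ψ x) - x * ψ x with hf0
  set f : ℝ → ℝ := fun x => f0 a + ∫ t in a..x, -ψ (p t) with hf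
  have hfd : ∀ x, HasDerivAt f (-ψ (p x)) x := fun x =>
    (hψp.neg.integral_hasStrictDerivAt a x).hasDerivAt.const_add _
  have hff0 : ∀ x ∈ Icc a b, f x = f0 x := by
    intro x hx
    have := intervalIntegral.integral_eq_sub_of_hasDerivAt_of_le (f := f0) (f' := fun t => -ψ (p t)) hx.1 ?_ ?_
      (hψp.neg.intervalIntegrable _ _)
    · simp only [hf]; rw [this]; ring
    · have : ContinuousOn f0 (Icc a b) :=
        (hd1.continuous.comp_continuousOn hψc).sub (continuousOn_id.mul hψc)
      exact this.mono (Icc_subset_Icc_right hx.2)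
    · intro t ht
      have ht' : t ∈ Ioo a b := ⟨ht.1, ht.2.trans_le hx.2⟩
      have htI : t ∈ Icc a b := Ioo_subset_Icc_self ht'
      have hnb : Icc a b ∈ 𝓝 t := Icc_mem_nhds ht'.1 ht'.2
      have hψd : HasDerivAt ψ (deriv (deriv h) (ψ t))⁻¹ t := by
        refine HasDerivAt.of_local_left_inverse (f := deriv h) (hψc.continuousAt hnb) (hd2 _).hasDerivAt
          (hposI _ (hψI t htI)).ne' ?_
        filter_upwards [hnb] with y hy using hψright y (hsub y hy)
      have h1 := ((hd1 (ψ t)).hasDerivAt.comp t hψd).fun_sub ((hasDerivAt_id t).fun_mul hψd)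
      rw [hψright t (hsub t htI)] at h1
      simp only [hpid t htI]
      convert h1 using 1
      · rfl
      · simp only [id]; ring
  have hinj : InjOn (fun x => -ψ (p x)) (Icc a b) := by
    intro x hx y hy hxy
    simp only [hpid x hx, hpid y hy, neg_inj] at hxy
    rw [← hψright x (hsub x hx), ← hψright y (hsub y hy), hxy]
  have hmain := equi_cos hab.le f _ g hψp.neg hgc hfd hinj _ hgC
  have hsubst : ∫ x in a..b, g x = ∫ u in ε..(π - ε), Real.sqrt (deriv (deriv h) u) := by
    rw [ha, hb, ← intervalIntegral.integral_comp_mul_deriv'' (f := deriv h) (f' := deriv (deriv h)) (g := g)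
      hd2.continuous.continuousOn (fun x _ => (hd2 x).hasDerivAt.hasDerivWithinAt) hc2.continuousOn hgc.continuousOn]
    refine intervalIntegral.integral_congr fun u hu => ?_
    rw [uIcc_of_le (by linarith)] at hu
    have hu' : u ∈ Icc 0 π := ⟨by linarith [hu.1], by linarith [hu.2]⟩
    have hab' : deriv h u ∈ Icc a b := ⟨(hmono.le_iff_le mε hu').2 hu.1, (hmono.le_iff_le hu' mε').2 hu.2⟩
    simp only [hg, Function.comp]
    rw [hpid _ hab', hψleft u hu', inv_mul_eq_div, Real.div_sqrt]
  rw [hsubst] at hmain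
  refine hmain.congr' ?_
  filter_upwards [eventually_gt_atTop 0] with n hn
  have hn' : (n : ℝ) ≠ 0 := by exact_mod_cast hn.ne'
  congr 1
  refine Finset.sum_congr rfl fun ν hν => ?_
  have hm := idx_mem hn hν
  simp only [hff0 _ hm, hg, hpid _ hm, hf0]
  congr 3
  field_simp
end
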